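/- Let Γ be a finite simple graph on m vertices equipped with a linear order on its edge set, and let N ≥ 2. Then for every d ≥ 0 the group H_d(Conf_Γ(ℝ^N); ℤ) is free abelian of rank equal to the number of NBC forests F of Γ with |F|·(N−1) = d; in particular these ranks are independent of the chosen edge order, and the Poincaré polynomial of Conf_Γ(ℝ^N) is Σ_{F an NBC forest of Γ} t^{|F|(N−1)}. -/

import Mathlib

/-!
STATEMENT 1: For a finite simple graph Γ on m vertices with a linear order on its
edges, and N ≥ 2, each homology group H_d(Conf_Γ(ℝ^N); ℤ) is free abelian of rank
equal to the number of NBC forests F of Γ with |F|(N−1) = d.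
-/

open CategoryTheory

/-- Singular homology with integer coefficients, as a functor. -/
noncomputable def singularHomologyFunctor (d : ℕ) : TopCat ⥤ ModuleCat ℤ :=
  TopCat.toSSet ⋙ ((SimplicialObject.whiskering _ _).obj (ModuleCat.free ℤ)) ⋙
    AlgebraicTopology.alternatingFaceMapComplex (ModuleCat ℤ) ⋙
    HomologicalComplex.homologyFunctor (ModuleCat ℤ) (ComplexShape.down ℕ) d

/-- `SH d X` is the `d`-th integral singular homology group of `X`. -/
noncomputable abbrev SH (d : ℕ) (X : Type) [TopologicalSpace X] : ModuleCat ℤ :=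
  (singularHomologyFunctor d).obj (TopCat.of X)

/-- The chromatic configuration space `Conf_Γ(ℝ^N)`. -/
abbrev chromConf (N m : ℕ) (G : SimpleGraph (Fin m)) : Type :=
  {x : Fin m → EuclideanSpace ℝ (Fin N) // ∀ i j, G.Adj i j → x i ≠ x j}

/-- The edge set of a cycle of the graph `H`. -/
def isCycleEdges {W : Type} [DecidableEq W] (H : SimpleGraph W)
    (C : Finset (Sym2 W)) : Prop :=
  ∃ (v : W) (w : H.Walk v v), w.IsCycle ∧ C = w.edges.toFinset

/-- `B` is a broken circuit of `H` with respect to the edge order `le`: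
the edge set of a cycle with its largest edge removed. -/
def isBrokenCircuit {W : Type} [DecidableEq W] (H : SimpleGraph W)
    (le : Sym2 W → Sym2 W → Prop) (B : Finset (Sym2 W)) : Prop :=
  ∃ C e, isCycleEdges H C ∧ e ∈ C ∧ (∀ f ∈ C, le f e) ∧ B = C.erase e

/-- An edge set is NBC if it contains no broken circuit. -/
def isNBC {W : Type} [DecidableEq W] (H : SimpleGraph W)
    (le : Sym2 W → Sym2 W → Prop) (F : Finset (Sym2 W)) : Prop :=
  ∀ B, isBrokenCircuit H le B → ¬ B ⊆ F

/-- A forest in `H`: an acyclic set of edges of `H`. -/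
def isForestIn {W : Type} (H : SimpleGraph W) (F : Finset (Sym2 W)) : Prop :=
  (↑F : Set (Sym2 W)) ⊆ H.edgeSet ∧
    (SimpleGraph.fromEdgeSet (↑F : Set (Sym2 W))).IsAcyclic

/-- The integral singular chain complex functor. -/
noncomputable def singC : TopCat ⥤ ChainComplex (ModuleCat ℤ) ℕ :=
  TopCat.toSSet ⋙ ((SimplicialObject.whiskering _ _).obj (ModuleCat.free ℤ)) ⋙
    AlgebraicTopology.alternatingFaceMapComplex (ModuleCat ℤ)

/-- The singular simplices form a basis of the singular chains. -/
noncomputable def sbasis (X : Type) [TopologicalSpace X] (n : ℕ) :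
    Module.Basis C(stdSimplex ℝ (Fin (n + 1)), X) ℤ ((singC.obj (TopCat.of X)).X n) :=
  (Finsupp.basisSingleOne (R := ℤ)
    (ι := (TopCat.toSSet.obj (TopCat.of X)).obj (Opposite.op (SimplexCategory.mk n)))).reindex
    (TopCat.toSSetObjEquiv (TopCat.of X) (Opposite.op (SimplexCategory.mk n)))

/-- The singular chain given by one simplex of the singular simplicial set. -/
noncomputable def singMk {X : TopCat} {n : ℕ}
    (x : (TopCat.toSSet.obj X).obj (Opposite.op (SimplexCategory.mk n))) :
    (singC.obj X).X n :=
  ModuleCat.freeMk (R := ℤ) x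

lemma basisSingleOne_reindex_apply {ι κ : Type} (e : ι ≃ κ) (j : κ) :
    (Finsupp.basisSingleOne (R := ℤ)).reindex e j = Finsupp.single (e.symm j) (1 : ℤ) := by
  simp

lemma sbasis_apply (X : Type) [TopologicalSpace X] (n : ℕ)
    (σ : C(stdSimplex ℝ (Fin (n + 1)), X)) : sbasis X n σ =
    singMk ((TopCat.toSSetObjEquiv (TopCat.of X)
      (Opposite.op (SimplexCategory.mk n))).symm σ) := by
  exact basisSingleOne_reindex_apply _ _

lemma map_sbasis {X Y : Type} [TopologicalSpace X] [TopologicalSpace Y] (f : C(X, Y)) (n : ℕ)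
    (σ : C(stdSimplex ℝ (Fin (n + 1)), X)) :
    ((singC.map (TopCat.ofHom f)).f n).hom (sbasis X n σ) = sbasis Y n (f.comp σ) := by
  rw [sbasis_apply, sbasis_apply]
  exact ModuleCat.free_map_apply _ _

/-- The `i`-th face inclusion of the standard simplex. -/
noncomputable def face (n : ℕ) (i : Fin (n + 2)) :
    C(stdSimplex ℝ (Fin (n + 1)), stdSimplex ℝ (Fin (n + 2))) :=
  ⟨stdSimplex.map i.succAbove, stdSimplex.continuous_map _⟩

lemma alternatingFaceMapComplex_free_d (X : SSet.{0}) (n : ℕ)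
    (x : X.obj (Opposite.op (SimplexCategory.mk (n + 1)))) :
    (((AlgebraicTopology.alternatingFaceMapComplex (ModuleCat ℤ)).obj
      (((SimplicialObject.whiskering _ _).obj (ModuleCat.free ℤ)).obj X)).d (n + 1) n).hom
      (ModuleCat.freeMk (R := ℤ) x : (ModuleCat.free ℤ).obj _) =
      (∑ i : Fin (n + 2), (-1 : ℤ) ^ (i : ℕ) •
        (ModuleCat.freeMk (R := ℤ) (X.δ i x) : (ModuleCat.free ℤ).obj _) :
        (ModuleCat.free ℤ).obj _) := by
  rw [AlgebraicTopology.alternatingFaceMapComplex_obj_d]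
  change (∑ i : Fin (n + 2), (-1 : ℤ) ^ (i : ℕ) • (ModuleCat.free ℤ).map (X.δ i)).hom _ = _
  rw [ModuleCat.hom_sum, LinearMap.sum_apply]
  refine Finset.sum_congr rfl fun i _ => ?_
  rw [← ModuleCat.free_map_apply]
  rfl

lemma d_sbasis {X : Type} [TopologicalSpace X] (n : ℕ)
    (σ : C(stdSimplex ℝ (Fin (n + 2)), X)) :
    ((singC.obj (TopCat.of X)).d (n + 1) n).hom (sbasis X (n + 1) σ) =
      ∑ i : Fin (n + 2), (-1 : ℤ) ^ (i : ℕ) • sbasis X n (σ.comp (face n i)) := by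
  simp only [sbasis_apply]
  exact alternatingFaceMapComplex_free_d (TopCat.toSSet.obj (TopCat.of X)) n _

/-- Formal chains on tuples of `n` points of `E`. -/
abbrev TupleChain (E : Type) (n : ℕ) : Type := (Fin n → E) →₀ ℤ

namespace TupleChain

variable {E E' : Type}

/-- The boundary of a formal chain, omitting the points of a tuple in turn. -/
noncomputable def bd (n : ℕ) : TupleChain E (n + 1) →ₗ[ℤ] TupleChain E n :=
  Finsupp.linearCombination ℤ fun p =>
    ∑ i : Fin (n + 1), (-1 : ℤ) ^ (i : ℕ) • Finsupp.single (p ∘ i.succAbove) 1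

/-- The cone of a formal chain with a given apex. -/
noncomputable def cone (b : E) (n : ℕ) : TupleChain E n →ₗ[ℤ] TupleChain E (n + 1) :=
  Finsupp.linearCombination ℤ fun p => Finsupp.single (Fin.cons b p : Fin (n + 1) → E) 1

/-- The map of formal chains induced by a map of points. -/
noncomputable def map (θ : E → E') (n : ℕ) : TupleChain E n →ₗ[ℤ] TupleChain E' n :=
  Finsupp.linearCombination ℤ fun p => Finsupp.single (θ ∘ p) 1

lemma bd_single (n : ℕ) (p : Fin (n + 1) → E) : bd n (Finsupp.single p 1) =
    ∑ i : Fin (n + 1), (-1 : ℤ) ^ (i : ℕ) • Finsupp.single (p ∘ i.succAbove) 1 := by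
  simp [bd]

lemma cone_single (b : E) (n : ℕ) (p : Fin n → E) : cone b n (Finsupp.single p 1) =
    Finsupp.single (Fin.cons b p : Fin (n + 1) → E) 1 := by
  simp [cone]

lemma map_single (θ : E → E') (n : ℕ) (p : Fin n → E) : map θ n (Finsupp.single p 1) =
    Finsupp.single (θ ∘ p) 1 := by
  simp [map]

lemma bd_cone_zero (b : E) (c : TupleChain E 0) : bd 0 (cone b 0 c) = c := by
  suffices h : bd 0 ∘ₗ cone b 0 = LinearMap.id from LinearMap.congr_fun h c
  ext p : 2
  ext
  simp [cone_single, bd_single, Subsingleton.elim _ p]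

lemma bd_cone (b : E) (n : ℕ) (c : TupleChain E (n + 1)) :
    bd (n + 1) (cone b (n + 1) c) = c - cone b n (bd n c) := by
  suffices h : bd (n + 1) ∘ₗ cone b (n + 1) = LinearMap.id - cone b n ∘ₗ bd n from
    LinearMap.congr_fun h c
  refine Finsupp.lhom_ext' fun p => LinearMap.ext_ring ?_
  simp only [LinearMap.comp_apply, Finsupp.lsingle_apply, LinearMap.sub_apply, cone_single,
    bd_single, map_sum, map_smul, LinearMap.id_apply]
  rw [Fin.sum_univ_succ, sub_eq_add_neg, ← Finset.sum_neg_distrib]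
  congr 1
  · simp only [Fin.val_zero, pow_zero, one_smul]
    congr 1
  · refine Finset.sum_congr rfl fun i _ => ?_
    rw [Fin.val_succ, pow_succ, mul_neg_one, neg_smul]
    congr 3
    funext j
    refine Fin.cases ?_ (fun j => ?_) j
    · simp
    · simp

lemma map_bd (θ : E → E') (n : ℕ) (c : TupleChain E (n + 1)) :
    map θ n (bd n c) = bd n (map θ (n + 1) c) := by
  suffices h : map θ n ∘ₗ bd n = bd n ∘ₗ map θ (n + 1) from LinearMap.congr_fun h c
  refine Finsupp.lhom_ext' fun p => LinearMap.ext_ring ?_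
  simp only [LinearMap.comp_apply, Finsupp.lsingle_apply, bd_single, map_sum, map_smul, map_single,
    Function.comp_assoc]

lemma map_cone (θ : E → E') (b : E) (n : ℕ) (c : TupleChain E n) :
    map θ (n + 1) (cone b n c) = cone (θ b) n (map θ n c) := by
  suffices h : map θ (n + 1) ∘ₗ cone b n = cone (θ b) n ∘ₗ map θ n from LinearMap.congr_fun h c
  refine Finsupp.lhom_ext' fun p => LinearMap.ext_ring ?_
  simp only [LinearMap.comp_apply, Finsupp.lsingle_apply, cone_single, map_single]
  congr 1
  funext j
  refine Fin.cases ?_ (fun j => ?_) j <;> simp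

lemma bd_bd (n : ℕ) (c : TupleChain E (n + 2)) : bd n (bd (n + 1) c) = 0 := by
  suffices h : bd n ∘ₗ bd (n + 1) = (0 : TupleChain E (n + 2) →ₗ[ℤ] _) from
    LinearMap.congr_fun h c
  refine Finsupp.lhom_ext' fun p => LinearMap.ext_ring ?_
  simp only [LinearMap.comp_apply, Finsupp.lsingle_apply, LinearMap.zero_apply]
  have hp : (Finsupp.single p 1 : TupleChain E (n + 2)) =
      cone (p 0) (n + 1) (Finsupp.single (Fin.tail p) 1) := by
    rw [cone_single, Fin.cons_self_tail]
  rw [hp, bd_cone, map_sub]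
  cases n with
  | zero => rw [bd_cone_zero, sub_self]
  | succ n => rw [bd_cone, bd_bd n, map_zero, sub_zero, sub_self]

variable (b : ∀ n, (Fin (n + 1) → E) → E)

/-- Iterated subdivision of formal chains, coning over the points chosen by `b`. -/
noncomputable def sd : ∀ n, TupleChain E n →ₗ[ℤ] TupleChain E n
  | 0 => LinearMap.id
  | n + 1 => Finsupp.linearCombination ℤ fun p =>
      cone (b n p) n (sd n (bd n (Finsupp.single p 1)))

/-- The chain homotopy from the subdivision to the identity. -/
noncomputable def sdHtpy : ∀ n, TupleChain E n →ₗ[ℤ] TupleChain E (n + 1)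
  | 0 => 0
  | n + 1 => Finsupp.linearCombination ℤ fun p =>
      cone (b n p) (n + 1) (Finsupp.single p 1 - sdHtpy n (bd n (Finsupp.single p 1)))

lemma sd_single (n : ℕ) (p : Fin (n + 1) → E) : sd b (n + 1) (Finsupp.single p 1) =
    cone (b n p) n (sd b n (bd n (Finsupp.single p 1))) := by
  simp [sd]

lemma sdHtpy_single (n : ℕ) (p : Fin (n + 1) → E) : sdHtpy b (n + 1) (Finsupp.single p 1) =
    cone (b n p) (n + 1) (Finsupp.single p 1 - sdHtpy b n (bd n (Finsupp.single p 1))) := by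
  simp [sdHtpy]

lemma bd_sdHtpy (n : ℕ) (c : TupleChain E (n + 1)) :
    bd (n + 1) (sdHtpy b (n + 1) c) = c - sd b (n + 1) c - sdHtpy b n (bd n c) := by
  induction n with
  | zero =>
    suffices h : bd 1 ∘ₗ sdHtpy b 1 = LinearMap.id - sd b 1 - sdHtpy b 0 ∘ₗ bd 0 from
      LinearMap.congr_fun h c
    refine Finsupp.lhom_ext' fun p => LinearMap.ext_ring ?_
    simp only [LinearMap.comp_apply, Finsupp.lsingle_apply, LinearMap.sub_apply,
      LinearMap.id_apply]
    rw [sdHtpy_single, bd_cone, sd_single]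
    simp [sdHtpy, sd]
  | succ n ih =>
    suffices h : bd (n + 2) ∘ₗ sdHtpy b (n + 2) =
        LinearMap.id - sd b (n + 2) - sdHtpy b (n + 1) ∘ₗ bd (n + 1) from
      LinearMap.congr_fun h c
    refine Finsupp.lhom_ext' fun p => LinearMap.ext_ring ?_
    simp only [LinearMap.comp_apply, Finsupp.lsingle_apply, LinearMap.sub_apply,
      LinearMap.id_apply]
    rw [sdHtpy_single, bd_cone, sd_single, map_sub, ih, bd_bd, map_zero, sub_zero]
    rw [sub_sub_cancel]
    abel

variable {b} {b' : ∀ n, (Fin (n + 1) → E') → E'}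

lemma map_sd {θ : E → E'} (hθ : ∀ n p, θ (b n p) = b' n (θ ∘ p)) (n : ℕ) (c : TupleChain E n) :
    map θ n (sd b n c) = sd b' n (map θ n c) := by
  induction n with
  | zero => simp [sd]
  | succ n ih =>
    suffices h : map θ (n + 1) ∘ₗ sd b (n + 1) = sd b' (n + 1) ∘ₗ map θ (n + 1) from
      LinearMap.congr_fun h c
    refine Finsupp.lhom_ext' fun p => LinearMap.ext_ring ?_
    simp only [LinearMap.comp_apply, Finsupp.lsingle_apply]
    rw [sd_single, map_cone, hθ, ih, map_bd, map_single, sd_single]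

lemma map_sdHtpy {θ : E → E'} (hθ : ∀ n p, θ (b n p) = b' n (θ ∘ p)) (n : ℕ)
    (c : TupleChain E n) :
    map θ (n + 1) (sdHtpy b n c) = sdHtpy b' n (map θ n c) := by
  induction n with
  | zero => simp [sdHtpy]
  | succ n ih =>
    suffices h : map θ (n + 2) ∘ₗ sdHtpy b (n + 1) = sdHtpy b' (n + 1) ∘ₗ map θ (n + 1) from
      LinearMap.congr_fun h c
    refine Finsupp.lhom_ext' fun p => LinearMap.ext_ring ?_
    simp only [LinearMap.comp_apply, Finsupp.lsingle_apply]
    rw [sdHtpy_single, map_cone, hθ, map_sub, ih, map_bd, map_single, sdHtpy_single]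

end TupleChain

/-- The affine map of standard simplices with given images of the vertices. -/
noncomputable def affMap {n k : ℕ} (p : Fin (k + 1) → stdSimplex ℝ (Fin (n + 1))) :
    C(stdSimplex ℝ (Fin (k + 1)), stdSimplex ℝ (Fin (n + 1))) where
  toFun t := ⟨∑ i, t.1 i • (p i).1,
    (convex_stdSimplex ℝ _).sum_mem (fun i _ => t.2.1 i) t.2.2 fun i _ => (p i).2⟩
  continuous_toFun := by
    refine Continuous.subtype_mk ?_ _
    exact continuous_finsetSum _ fun i _ =>
      ((continuous_apply i).comp continuous_subtype_val).smul continuous_const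

lemma affMap_coe {n k : ℕ} (p : Fin (k + 1) → stdSimplex ℝ (Fin (n + 1)))
    (t : stdSimplex ℝ (Fin (k + 1))) :
    ((affMap p t : stdSimplex ℝ (Fin (n + 1))) : Fin (n + 1) → ℝ) =
      ∑ i, (t : Fin (k + 1) → ℝ) i • (p i : Fin (n + 1) → ℝ) := rfl

lemma affMap_comp {n k l : ℕ} (p : Fin (k + 1) → stdSimplex ℝ (Fin (n + 1)))
    (q : Fin (l + 1) → stdSimplex ℝ (Fin (k + 1))) :
    (affMap p).comp (affMap q) = affMap (affMap p ∘ q) := by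
  ext t j
  simp only [ContinuousMap.comp_apply, affMap_coe, Function.comp_apply, Finset.sum_apply,
    Pi.smul_apply, smul_eq_mul, Finset.sum_mul, Finset.mul_sum]
  rw [Finset.sum_comm]
  simp only [mul_assoc]

lemma affMap_vertex (n : ℕ) : affMap (fun i => stdSimplex.vertex (S := ℝ) i) =
    ContinuousMap.id (stdSimplex ℝ (Fin (n + 1))) := by
  ext t j
  simp [affMap_coe, Finset.sum_apply, Pi.single_apply]

lemma affMap_comp_face {n k : ℕ} (p : Fin (k + 2) → stdSimplex ℝ (Fin (n + 1)))
    (i : Fin (k + 2)) : (affMap p).comp (face k i) = affMap (p ∘ i.succAbove) := by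
  have : face k i = affMap (fun j => stdSimplex.vertex (S := ℝ) (i.succAbove j)) := by
    ext t j
    simp [face, affMap_coe, FunOnFinite.linearMap_apply_apply, Finset.sum_apply, Pi.single_apply,
      Finset.sum_filter, eq_comm]
  rw [this, affMap_comp]
  congr 1
  funext j
  ext l
  simp only [affMap_coe, Function.comp_apply, stdSimplex.vertex_coe, Finset.sum_apply, Pi.smul_apply,
    Pi.single_apply, smul_eq_mul, ite_mul, one_mul, zero_mul, Finset.sum_ite_eq', Finset.mem_univ,
    if_true]

/-- The barycenter of a tuple of points of a standard simplex. -/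
noncomputable def bary {n : ℕ} (k : ℕ) (p : Fin (k + 1) → stdSimplex ℝ (Fin (n + 1))) :
    stdSimplex ℝ (Fin (n + 1)) :=
  affMap p stdSimplex.barycenter

lemma affMap_bary {n m : ℕ} (θ : Fin (n + 1) → stdSimplex ℝ (Fin (m + 1))) (k : ℕ)
    (p : Fin (k + 1) → stdSimplex ℝ (Fin (n + 1))) :
    affMap θ (bary k p) = bary k (affMap θ ∘ p) := by
  rw [bary, bary, ← affMap_comp]
  rfl

section

variable {X : Type} [TopologicalSpace X]

/-- The singular chain obtained by applying a singular simplex to affine simplices. -/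
noncomputable def push {n : ℕ} (σ : C(stdSimplex ℝ (Fin (n + 1)), X)) (k : ℕ) :
    TupleChain (stdSimplex ℝ (Fin (n + 1))) (k + 1) →ₗ[ℤ] (singC.obj (TopCat.of X)).X k :=
  Finsupp.linearCombination ℤ fun p => sbasis X k (σ.comp (affMap p))

lemma push_single {n : ℕ} (σ : C(stdSimplex ℝ (Fin (n + 1)), X)) (k : ℕ)
    (p : Fin (k + 1) → stdSimplex ℝ (Fin (n + 1))) :
    push σ k (Finsupp.single p 1) = sbasis X k (σ.comp (affMap p)) := by
  simp only [push, Finsupp.linearCombination_single]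
  exact one_smul ℤ _

lemma d_push {n : ℕ} (σ : C(stdSimplex ℝ (Fin (n + 1)), X)) (k : ℕ)
    (c : TupleChain (stdSimplex ℝ (Fin (n + 1))) (k + 2)) :
    ((singC.obj (TopCat.of X)).d (k + 1) k).hom (push σ (k + 1) c) =
      push σ k (TupleChain.bd (k + 1) c) := by
  suffices h : ((singC.obj (TopCat.of X)).d (k + 1) k).hom ∘ₗ push σ (k + 1) =
      push σ k ∘ₗ TupleChain.bd (k + 1) from LinearMap.congr_fun h c
  refine Finsupp.lhom_ext' fun p => LinearMap.ext_ring ?_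
  simp only [LinearMap.comp_apply, Finsupp.lsingle_apply, push_single, d_sbasis,
    TupleChain.bd_single, map_sum, map_zsmul, ContinuousMap.comp_assoc, affMap_comp_face]

lemma push_comp {n m : ℕ} (σ : C(stdSimplex ℝ (Fin (n + 1)), X))
    (θ : Fin (m + 1) → stdSimplex ℝ (Fin (n + 1))) (k : ℕ)
    (c : TupleChain (stdSimplex ℝ (Fin (m + 1))) (k + 1)) :
    push (σ.comp (affMap θ)) k c = push σ k (TupleChain.map (affMap θ) (k + 1) c) := by
  suffices h : push (σ.comp (affMap θ)) k = push σ k ∘ₗ TupleChain.map (affMap θ) (k + 1) from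
    LinearMap.congr_fun h c
  refine Finsupp.lhom_ext' fun p => LinearMap.ext_ring ?_
  simp only [LinearMap.comp_apply, Finsupp.lsingle_apply, push_single, TupleChain.map_single,
    ContinuousMap.comp_assoc, affMap_comp]

/-- The fundamental chain of the standard simplex. -/
noncomputable def fundChain (n : ℕ) : TupleChain (stdSimplex ℝ (Fin (n + 1))) (n + 1) :=
  Finsupp.single (fun i => stdSimplex.vertex i) 1

lemma push_fundChain {n : ℕ} (σ : C(stdSimplex ℝ (Fin (n + 1)), X)) :
    push σ n (fundChain n) = sbasis X n σ := by
  rw [fundChain, push_single, affMap_vertex]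
  rfl

lemma map_affMap_fundChain {n k : ℕ} (p : Fin (k + 1) → stdSimplex ℝ (Fin (n + 1))) :
    TupleChain.map (affMap p) (k + 1) (fundChain k) = Finsupp.single p 1 := by
  rw [fundChain, TupleChain.map_single]
  congr 1
  funext j
  ext l
  simp only [affMap_coe, Function.comp_apply, stdSimplex.vertex_coe, Finset.sum_apply, Pi.smul_apply,
    Pi.single_apply, smul_eq_mul, ite_mul, one_mul, zero_mul, Finset.sum_ite_eq', Finset.mem_univ,
    if_true]

variable (X)

/-- Barycentric subdivision of singular chains. -/
noncomputable def singSd (n : ℕ) :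
    (singC.obj (TopCat.of X)).X n →ₗ[ℤ] (singC.obj (TopCat.of X)).X n :=
  (sbasis X n).constr ℕ fun σ => push σ n (TupleChain.sd bary (n + 1) (fundChain n))

/-- The chain homotopy between barycentric subdivision and the identity. -/
noncomputable def singSdHtpy (n : ℕ) :
    (singC.obj (TopCat.of X)).X n →ₗ[ℤ] (singC.obj (TopCat.of X)).X (n + 1) :=
  (sbasis X n).constr ℕ fun σ => push σ (n + 1) (TupleChain.sdHtpy bary (n + 1) (fundChain n))

variable {X}

lemma singSd_push {n : ℕ} (σ : C(stdSimplex ℝ (Fin (n + 1)), X)) (k : ℕ)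
    (c : TupleChain (stdSimplex ℝ (Fin (n + 1))) (k + 1)) :
    singSd X k (push σ k c) = push σ k (TupleChain.sd bary (k + 1) c) := by
  suffices h : singSd X k ∘ₗ push σ k = push σ k ∘ₗ TupleChain.sd bary (k + 1) from
    LinearMap.congr_fun h c
  refine Finsupp.lhom_ext' fun p => LinearMap.ext_ring ?_
  simp only [LinearMap.comp_apply, Finsupp.lsingle_apply, push_single]
  rw [singSd, Module.Basis.constr_basis, push_comp, TupleChain.map_sd (affMap_bary p),
    map_affMap_fundChain]

lemma singSdHtpy_push {n : ℕ} (σ : C(stdSimplex ℝ (Fin (n + 1)), X)) (k : ℕ)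
    (c : TupleChain (stdSimplex ℝ (Fin (n + 1))) (k + 1)) :
    singSdHtpy X k (push σ k c) = push σ (k + 1) (TupleChain.sdHtpy bary (k + 1) c) := by
  suffices h : singSdHtpy X k ∘ₗ push σ k =
      push σ (k + 1) ∘ₗ TupleChain.sdHtpy bary (k + 1) from
    LinearMap.congr_fun h c
  refine Finsupp.lhom_ext' fun p => LinearMap.ext_ring ?_
  simp only [LinearMap.comp_apply, Finsupp.lsingle_apply, push_single]
  rw [singSdHtpy, Module.Basis.constr_basis, push_comp, TupleChain.map_sdHtpy (affMap_bary p),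
    map_affMap_fundChain]

lemma d_singSdHtpy_zero (c : (singC.obj (TopCat.of X)).X 0) :
    ((singC.obj (TopCat.of X)).d 1 0).hom (singSdHtpy X 0 c) = c - singSd X 0 c := by
  suffices h : ((singC.obj (TopCat.of X)).d 1 0).hom ∘ₗ singSdHtpy X 0 =
      LinearMap.id - singSd X 0 from LinearMap.congr_fun h c
  refine (sbasis X 0).ext fun σ => ?_
  simp only [LinearMap.comp_apply, LinearMap.sub_apply, LinearMap.id_apply]
  rw [← push_fundChain, singSdHtpy_push, d_push, TupleChain.bd_sdHtpy, singSd_push]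
  simp [TupleChain.sdHtpy]

lemma d_singSdHtpy_succ (n : ℕ) (c : (singC.obj (TopCat.of X)).X (n + 1)) :
    ((singC.obj (TopCat.of X)).d (n + 2) (n + 1)).hom (singSdHtpy X (n + 1) c) =
      c - singSd X (n + 1) c -
        singSdHtpy X n (((singC.obj (TopCat.of X)).d (n + 1) n).hom c) := by
  suffices h : ((singC.obj (TopCat.of X)).d (n + 2) (n + 1)).hom ∘ₗ singSdHtpy X (n + 1) =
      LinearMap.id - singSd X (n + 1) -
        singSdHtpy X n ∘ₗ ((singC.obj (TopCat.of X)).d (n + 1) n).hom from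
    LinearMap.congr_fun h c
  refine (sbasis X (n + 1)).ext fun σ => ?_
  simp only [LinearMap.comp_apply, LinearMap.sub_apply, LinearMap.id_apply]
  rw [← push_fundChain, singSdHtpy_push, d_push, d_push, TupleChain.bd_sdHtpy, singSd_push,
    singSdHtpy_push, map_sub, map_sub]

end

section

variable {m : ℕ}

lemma norm_sum_le_of_eq_zero {k : ℕ} {F : Type} [SeminormedAddCommGroup F]
    (v : Fin (k + 1) → F) (j : Fin (k + 1)) (hj : v j = 0) {D : ℝ} (hD : ∀ i, ‖v i‖ ≤ D) :
    ‖∑ i, v i‖ ≤ k * D := by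
  rw [Fin.sum_univ_succAbove _ j, hj, zero_add]
  refine (norm_sum_le _ _).trans ?_
  refine (Finset.sum_le_card_nsmul _ _ D fun i _ => hD _).trans ?_
  simp

lemma dist_bary_le {k : ℕ} (p : Fin (k + 1) → stdSimplex ℝ (Fin (m + 1))) {D : ℝ}
    (hD : ∀ i j, dist (p i) (p j) ≤ D) (j : Fin (k + 1)) :
    dist (p j) (bary k p) ≤ (k / (k + 1) : ℝ) * D := by
  rw [dist_comm, Subtype.dist_eq, dist_eq_norm]
  have h1 : (bary k p).1 - (p j).1 = ((k : ℝ) + 1)⁻¹ • ∑ i, ((p i).1 - (p j).1) := by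
    have h2 : (bary k p).1 = ((k : ℝ) + 1)⁻¹ • ∑ i, (p i).1 := by
      have := affMap_coe p stdSimplex.barycenter
      rw [Finset.smul_sum]
      refine this.trans (Finset.sum_congr rfl fun i _ => ?_)
      congr 1
      refine (stdSimplex.barycenter_apply (𝕜 := ℝ) i).trans ?_
      simp
    rw [h2, Finset.sum_sub_distrib, smul_sub]
    congr 1
    simp only [Finset.sum_const, Finset.card_univ, Fintype.card_fin]
    rw [← Nat.cast_smul_eq_nsmul ℝ, smul_smul]
    push_cast
    rw [inv_mul_cancel₀ (by positivity), one_smul]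
  rw [h1, norm_smul, Real.norm_of_nonneg (by positivity)]
  have h3 := norm_sum_le_of_eq_zero (fun i => (p i).1 - (p j).1) j (sub_self _)
    (D := D) (fun i => by rw [← dist_eq_norm, ← Subtype.dist_eq]; exact hD i j)
  calc ((k : ℝ) + 1)⁻¹ * _ ≤ ((k : ℝ) + 1)⁻¹ * (k * D) := by gcongr
    _ = _ := by ring

lemma dist_le_of_mem_convexHull {k : ℕ} (p : Fin k → stdSimplex ℝ (Fin (m + 1)))
    {x y : stdSimplex ℝ (Fin (m + 1))} {D : ℝ} (hD : ∀ i, dist (p i) y ≤ D)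
    (hx : x.1 ∈ convexHull ℝ (Set.range fun i => (p i).1)) : dist x y ≤ D := by
  have : convexHull ℝ (Set.range fun i => (p i).1) ⊆ Metric.closedBall y.1 D := by
    refine convexHull_min ?_ (convex_closedBall _ _)
    rintro _ ⟨i, rfl⟩
    exact hD i
  exact this hx

lemma affMap_mem_convexHull {k : ℕ} (p : Fin (k + 1) → stdSimplex ℝ (Fin (m + 1)))
    (t : stdSimplex ℝ (Fin (k + 1))) :
    (affMap p t).1 ∈ convexHull ℝ (Set.range fun i => (p i).1) :=
  (convex_convexHull ℝ _).sum_mem (fun i _ => t.2.1 i) t.2.2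
    fun i _ => subset_convexHull ℝ _ ⟨i, rfl⟩

/-- The tuples with entries in the convex hull of `p` and mutual distances at most `D`. -/
def smallTuples {k : ℕ} (p : Fin k → stdSimplex ℝ (Fin (m + 1))) (l : ℕ) (D : ℝ) :
    Set (Fin l → stdSimplex ℝ (Fin (m + 1))) :=
  {q | (∀ i, (q i).1 ∈ convexHull ℝ (Set.range fun i => (p i).1)) ∧ ∀ i j, dist (q i) (q j) ≤ D}

lemma sd_mem_supported (k : ℕ) (hk : k ≤ m + 1) (p : Fin k → stdSimplex ℝ (Fin (m + 1)))
    {D : ℝ} (hD : ∀ i j, dist (p i) (p j) ≤ D) :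
    TupleChain.sd bary k (Finsupp.single p 1) ∈
      Finsupp.supported ℤ ℤ (smallTuples p k ((m / (m + 1) : ℝ) * D)) := by
  induction k with
  | zero =>
    exact Finsupp.single_mem_supported ℤ _ ⟨fun i => i.elim0, fun i => i.elim0⟩
  | succ k ih =>
    have hD0 : 0 ≤ D := dist_nonneg.trans (hD 0 0)
    have hb : ∀ j, dist (p j) (bary k p) ≤ (m / (m + 1) : ℝ) * D := fun j => by
      refine (dist_bary_le p hD j).trans ?_
      have : (k : ℝ) ≤ m := by exact_mod_cast Nat.le_of_succ_le_succ hk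
      have : (k / (k + 1) : ℝ) ≤ m / (m + 1) := by
        rw [div_le_div_iff₀ (by positivity) (by positivity)]
        nlinarith
      gcongr
    have hc : TupleChain.sd bary k (TupleChain.bd k (Finsupp.single p 1)) ∈
        Finsupp.supported ℤ ℤ (smallTuples p k ((m / (m + 1) : ℝ) * D)) := by
      rw [TupleChain.bd_single, map_sum]
      refine Submodule.sum_mem _ fun i _ => ?_
      rw [map_smul]
      refine Submodule.smul_mem _ _ (Finsupp.supported_mono ?_
        (ih (by omega) (p ∘ i.succAbove) fun _ _ => hD _ _))
      exact fun q hq => ⟨fun j => convexHull_mono (by rintro _ ⟨l, rfl⟩; exact ⟨_, rfl⟩) (hq.1 j),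
        hq.2⟩
    rw [TupleChain.sd_single]
    generalize TupleChain.sd bary k (TupleChain.bd k (Finsupp.single p 1)) = c at hc
    rw [TupleChain.cone, Finsupp.linearCombination_apply]
    refine Submodule.sum_mem _ fun q hq => Submodule.smul_mem _ _ ?_
    have hq' := hc (hq)
    refine Finsupp.single_mem_supported ℤ _ ⟨fun i => ?_, fun i j => ?_⟩
    · refine Fin.cases ?_ (fun i => ?_) i
      · exact affMap_mem_convexHull _ _
      · exact hq'.1 i
    · have h0 : 0 ≤ (m / (m + 1) : ℝ) * D := by positivity
      have hbq : ∀ i, dist (q i) (bary k p) ≤ (m / (m + 1) : ℝ) * D := fun i =>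
        dist_le_of_mem_convexHull p hb (hq'.1 i)
      refine Fin.cases ?_ (fun i => ?_) i <;> refine Fin.cases ?_ (fun j => ?_) j
      · simpa using h0
      · simpa [dist_comm] using hbq j
      · simpa using hbq i
      · simpa using hq'.2 i j

lemma sd_iterate_mem_supported (l : ℕ) :
    (TupleChain.sd bary (m + 1))^[l] (fundChain m) ∈ Finsupp.supported ℤ ℤ
      {q : Fin (m + 1) → stdSimplex ℝ (Fin (m + 1)) | ∀ i j, dist (q i) (q j) ≤
        (m / (m + 1) : ℝ) ^ l * Metric.diam (Set.univ : Set (stdSimplex ℝ (Fin (m + 1))))} := by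
  induction l with
  | zero =>
    refine Finsupp.single_mem_supported ℤ _ fun i j => ?_
    rw [pow_zero, one_mul]
    exact Metric.dist_le_diam_of_mem isCompact_univ.isBounded trivial trivial
  | succ l ih =>
    rw [Function.iterate_succ_apply']
    generalize (TupleChain.sd bary (m + 1))^[l] (fundChain m) = c at ih
    rw [← Finsupp.sum_single c, Finsupp.sum, map_sum]
    refine Submodule.sum_mem _ fun q hq => ?_
    rw [show Finsupp.single q (c q) = c q • Finsupp.single q 1 by simp, map_smul]
    refine Submodule.smul_mem _ _ (Finsupp.supported_mono ?_
      (sd_mem_supported (m + 1) le_rfl q (ih hq)))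
    intro q' hq' i j
    rw [pow_succ', mul_assoc]
    exact hq'.2 i j

end

section

variable {X : Type} [TopologicalSpace X]

/-- The singular chains of `X` supported in a subset. -/
noncomputable def chainsIn (A : Set X) (n : ℕ) : Submodule ℤ ((singC.obj (TopCat.of X)).X n) :=
  Submodule.span ℤ (sbasis X n '' {σ | ∀ t, σ t ∈ A})

lemma sbasis_mem_chainsIn {A : Set X} {n : ℕ} {σ : C(stdSimplex ℝ (Fin (n + 1)), X)}
    (h : ∀ t, σ t ∈ A) : sbasis X n σ ∈ chainsIn A n :=
  Submodule.subset_span ⟨σ, h, rfl⟩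

lemma chainsIn_mono {A B : Set X} (h : A ⊆ B) (n : ℕ) : chainsIn A n ≤ chainsIn B n :=
  Submodule.span_mono (Set.image_mono fun _ hσ t => h (hσ t))

lemma chainsIn_le {A : Set X} {n : ℕ} {S : Submodule ℤ ((singC.obj (TopCat.of X)).X n)}
    (h : ∀ σ : C(stdSimplex ℝ (Fin (n + 1)), X), (∀ t, σ t ∈ A) → sbasis X n σ ∈ S) :
    chainsIn A n ≤ S := by
  refine Submodule.span_le.2 ?_
  rintro _ ⟨σ, hσ, rfl⟩
  exact h σ hσ

lemma push_mem_chainsIn {A : Set X} {n k : ℕ} {σ : C(stdSimplex ℝ (Fin (n + 1)), X)}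
    (hσ : ∀ t, σ t ∈ A) (c : TupleChain (stdSimplex ℝ (Fin (n + 1))) (k + 1)) :
    push σ k c ∈ chainsIn A k := by
  rw [push, Finsupp.linearCombination_apply]
  exact Submodule.sum_mem _ fun q _ => Submodule.smul_mem _ _
    (sbasis_mem_chainsIn fun t => hσ _)

lemma singSd_mem_chainsIn {A : Set X} {n : ℕ} {c : (singC.obj (TopCat.of X)).X n}
    (hc : c ∈ chainsIn A n) : singSd X n c ∈ chainsIn A n := by
  refine chainsIn_le (S := (chainsIn A n).comap (singSd X n)) (fun σ hσ => ?_) hc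
  rw [Submodule.mem_comap, singSd, Module.Basis.constr_basis]
  exact push_mem_chainsIn hσ _

lemma singSdHtpy_mem_chainsIn {A : Set X} {n : ℕ} {c : (singC.obj (TopCat.of X)).X n}
    (hc : c ∈ chainsIn A n) : singSdHtpy X n c ∈ chainsIn A (n + 1) := by
  refine chainsIn_le (S := (chainsIn A (n + 1)).comap (singSdHtpy X n)) (fun σ hσ => ?_) hc
  rw [Submodule.mem_comap, singSdHtpy, Module.Basis.constr_basis]
  exact push_mem_chainsIn hσ _

lemma d_mem_chainsIn {A : Set X} {n : ℕ} {c : (singC.obj (TopCat.of X)).X (n + 1)}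
    (hc : c ∈ chainsIn A (n + 1)) :
    ((singC.obj (TopCat.of X)).d (n + 1) n).hom c ∈ chainsIn A n := by
  refine chainsIn_le
    (S := (chainsIn A n).comap ((singC.obj (TopCat.of X)).d (n + 1) n).hom) (fun σ hσ => ?_) hc
  rw [Submodule.mem_comap, d_sbasis]
  exact Submodule.sum_mem _ fun i _ =>
    zsmul_mem (sbasis_mem_chainsIn (σ := σ.comp (face n i)) fun t => hσ _) _

lemma chainsIn_inter (A B : Set X) (n : ℕ) :
    chainsIn (A ∩ B) n = chainsIn A n ⊓ chainsIn B n := by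
  ext c
  simp only [chainsIn, Submodule.mem_inf, Module.Basis.mem_span_image, ← Set.subset_inter_iff]
  have : {σ : C(stdSimplex ℝ (Fin (n + 1)), X) | ∀ t, σ t ∈ A ∩ B} =
      {σ | ∀ t, σ t ∈ A} ∩ {σ | ∀ t, σ t ∈ B} := by
    ext σ
    simp [forall_and]
  rw [this]

lemma exists_singSd_iterate_sbasis_mem {A B : Set X} (hA : IsOpen A) (hB : IsOpen B) {n : ℕ}
    (σ : C(stdSimplex ℝ (Fin (n + 1)), X)) (hσ : ∀ t, σ t ∈ A ∪ B) :
    ∃ l, (singSd X n)^[l] (sbasis X n σ) ∈ chainsIn A n ⊔ chainsIn B n := by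
  obtain ⟨δ, hδ, h⟩ := lebesgue_number_lemma_of_metric (s := Set.univ)
    (c := fun b : Bool => if b then σ ⁻¹' A else σ ⁻¹' B) isCompact_univ
    (by rintro (_ | _); exacts [hB.preimage σ.continuous, hA.preimage σ.continuous])
    (fun t _ => by
      rw [Set.mem_iUnion]
      exact (hσ t).elim (fun h => ⟨true, h⟩) fun h => ⟨false, h⟩)
  have hlim : Filter.Tendsto (fun l : ℕ => (n / (n + 1) : ℝ) ^ l *
      Metric.diam (Set.univ : Set (stdSimplex ℝ (Fin (n + 1))))) Filter.atTop (nhds 0) := by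
    rw [← zero_mul (Metric.diam (Set.univ : Set (stdSimplex ℝ (Fin (n + 1)))))]
    refine (tendsto_pow_atTop_nhds_zero_of_lt_one (by positivity) ?_).mul_const _
    rw [div_lt_one (by positivity)]
    linarith
  obtain ⟨l, hl⟩ := (hlim.eventually (gt_mem_nhds hδ)).exists
  refine ⟨l, ?_⟩
  have key : (singSd X n)^[l] (sbasis X n σ) =
      push σ n ((TupleChain.sd bary (n + 1))^[l] (fundChain n)) := by
    rw [← push_fundChain]
    exact (Function.Semiconj.iterate_right (fun c => (singSd_push σ n c).symm) l _).symm
  rw [key, push, Finsupp.linearCombination_apply]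
  refine Submodule.sum_mem _ fun q hq => Submodule.smul_mem _ _ ?_
  have hq' := sd_iterate_mem_supported l (hq)
  have hball : ∀ t, affMap q t ∈ Metric.ball (q 0) δ := fun t =>
    (dist_le_of_mem_convexHull q (fun i => hq' i 0) (affMap_mem_convexHull q t)).trans_lt hl
  obtain ⟨b, hb⟩ := h (q 0) trivial
  cases b with
  | true => exact Submodule.mem_sup_left (sbasis_mem_chainsIn fun t => hb (hball t))
  | false => exact Submodule.mem_sup_right (sbasis_mem_chainsIn fun t => hb (hball t))

lemma singSd_iterate_mem_sup {A B : Set X} {n : ℕ} {c : (singC.obj (TopCat.of X)).X n}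
    (hc : c ∈ chainsIn A n ⊔ chainsIn B n) (l : ℕ) :
    (singSd X n)^[l] c ∈ chainsIn A n ⊔ chainsIn B n := by
  induction l with
  | zero => exact hc
  | succ l ih =>
    rw [Function.iterate_succ_apply']
    obtain ⟨a, ha, b, hb, h⟩ := Submodule.mem_sup.1 ih
    rw [← h, map_add]
    exact Submodule.add_mem_sup (singSd_mem_chainsIn ha) (singSd_mem_chainsIn hb)

lemma exists_singSd_iterate_mem {A B : Set X} (hA : IsOpen A) (hB : IsOpen B) {n : ℕ}
    {c : (singC.obj (TopCat.of X)).X n} (hc : c ∈ chainsIn (A ∪ B) n) :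
    ∃ l, (singSd X n)^[l] c ∈ chainsIn A n ⊔ chainsIn B n := by
  have hiter : ∀ l, ∃ f : (singC.obj (TopCat.of X)).X n →ₗ[ℤ] (singC.obj (TopCat.of X)).X n,
      ∀ c, (singSd X n)^[l] c = f c := fun l =>
    ⟨(singSd X n) ^ l, fun c => (Module.End.pow_apply _ _ _).symm⟩
  induction hc using Submodule.span_induction with
  | mem x hx =>
    obtain ⟨σ, hσ, rfl⟩ := hx
    exact exists_singSd_iterate_sbasis_mem hA hB σ hσ
  | zero => exact ⟨0, Submodule.zero_mem _⟩
  | add x y _ _ hx hy =>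
    obtain ⟨l, hl⟩ := hx
    obtain ⟨k, hk⟩ := hy
    refine ⟨l + k, ?_⟩
    obtain ⟨f, hf⟩ := hiter (l + k)
    rw [hf, map_add, ← hf, ← hf]
    refine Submodule.add_mem _ ?_ ?_
    · rw [add_comm, Function.iterate_add_apply]
      exact singSd_iterate_mem_sup hl k
    · rw [Function.iterate_add_apply]
      exact singSd_iterate_mem_sup hk l
  | smul a x _ hx =>
    obtain ⟨l, hl⟩ := hx
    refine ⟨l, ?_⟩
    obtain ⟨f, hf⟩ := hiter l
    rw [hf, map_smul, ← hf]
    exact Submodule.smul_mem _ _ hl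

end

section

variable {R : Type} [CommRing R]

variable (R) in
/-- Chain complexes of modules. -/
abbrev Cx := ChainComplex (ModuleCat.{0} R) ℕ

lemma cx_acyclic_iff (K : Cx R) : K.Acyclic ↔ ∀ (n : ℕ) (x : K.X n),
    (∀ j, (K.d n j).hom x = 0) → ∃ y : K.X (n + 1), (K.d (n + 1) n).hom y = x := by
  refine forall_congr' fun n => ?_
  rw [K.exactAt_iff' (n + 1) n ((ComplexShape.down ℕ).next n) (by simp) rfl,
    ShortComplex.moduleCat_exact_iff]
  refine forall_congr' fun x => imp_congr ⟨fun h j => ?_, fun h => h _⟩ Iff.rfl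
  by_cases hj : (ComplexShape.down ℕ).Rel n j
  · rw [← (ComplexShape.down ℕ).next_eq' hj]
    exact h
  · rw [K.shape n j hj]
    rfl

lemma cx_shortExact {S : ShortComplex (Cx R)} (hf : ∀ n, Function.Injective (S.f.f n).hom)
    (hg : ∀ n, Function.Surjective (S.g.f n).hom)
    (h : ∀ n x, (S.g.f n).hom x = 0 → ∃ y, (S.f.f n).hom y = x) : S.ShortExact := by
  refine HomologicalComplex.shortExact_of_degreewise_shortExact _ fun n => ?_
  exact {
    exact := by
      rw [ShortComplex.moduleCat_exact_iff]
      exact h n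
    mono_f := (ModuleCat.mono_iff_injective _).2 (hf n)
    epi_g := (ModuleCat.epi_iff_surjective _).2 (hg n) }

lemma cx_comm {K L : Cx R} (f : K ⟶ L) (i j : ℕ) (x : K.X i) :
    (L.d i j).hom ((f.f i).hom x) = (f.f j).hom ((K.d i j).hom x) :=
  LinearMap.congr_fun (congrArg ModuleCat.Hom.hom (f.comm i j)) x

lemma cx_d_d (K : Cx R) (i j k : ℕ) (x : K.X i) :
    (K.d j k).hom ((K.d i j).hom x) = 0 :=
  LinearMap.congr_fun (congrArg ModuleCat.Hom.hom (K.d_comp_d i j k)) x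

/-- A subcomplex of a chain complex of modules. -/
structure SubCx (K : Cx R) where
  /-- The chains of the subcomplex. -/
  S : ∀ n, Submodule R (K.X n)
  d_mem : ∀ i j x, x ∈ S i → (K.d i j).hom x ∈ S j

namespace SubCx

variable {K L M : Cx R}

/-- The subcomplex as a complex. -/
def sub (T : SubCx K) : Cx R where
  X n := ModuleCat.of R (T.S n)
  d i j := ModuleCat.ofHom ((K.d i j).hom.restrict (T.d_mem i j))
  shape i j h := by
    ext x
    exact (LinearMap.congr_fun (congrArg ModuleCat.Hom.hom (K.shape i j h)) x.1)
  d_comp_d' i j k _ _ := by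
    ext x
    exact cx_d_d K i j k x.1

/-- The inclusion of a subcomplex. -/
def ι (T : SubCx K) : T.sub ⟶ K where
  f n := ModuleCat.ofHom (T.S n).subtype
  comm' _ _ _ := rfl

/-- The quotient by a subcomplex. -/
def quot (T : SubCx K) : Cx R where
  X n := ModuleCat.of R (K.X n ⧸ T.S n)
  d i j := ModuleCat.ofHom (Submodule.mapQ _ _ (K.d i j).hom (T.d_mem i j))
  shape i j h := by
    ext x
    have := LinearMap.congr_fun (congrArg ModuleCat.Hom.hom (K.shape i j h)) x
    exact congrArg (Submodule.Quotient.mk (p := T.S j)) this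
  d_comp_d' i j k _ _ := by
    ext x
    exact congrArg (Submodule.Quotient.mk (p := T.S k)) (cx_d_d K i j k x)

/-- The projection to the quotient by a subcomplex. -/
def π (T : SubCx K) : K ⟶ T.quot where
  f n := ModuleCat.ofHom (T.S n).mkQ
  comm' _ _ _ := rfl

/-- The class of a chain in the quotient by a subcomplex. -/
def cls (T : SubCx K) {n : ℕ} (x : K.X n) : T.quot.X n := Submodule.Quotient.mk (p := T.S n) x

lemma cls_surjective (T : SubCx K) {n : ℕ} : Function.Surjective (T.cls (n := n)) :=
  Submodule.Quotient.mk_surjective _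

lemma cls_eq_zero (T : SubCx K) {n : ℕ} {x : K.X n} : T.cls x = 0 ↔ x ∈ T.S n :=
  Submodule.Quotient.mk_eq_zero _

lemma cls_eq (T : SubCx K) {n : ℕ} {x y : K.X n} : T.cls x = T.cls y ↔ x - y ∈ T.S n :=
  Submodule.Quotient.eq _

lemma d_cls (T : SubCx K) {i j : ℕ} (x : K.X i) :
    (T.quot.d i j).hom (T.cls x) = T.cls ((K.d i j).hom x) := rfl

/-- The map of quotients induced by a chain map. -/
def mapQ (T : SubCx K) (T' : SubCx L) (f : K ⟶ L)
    (h : ∀ n x, x ∈ T.S n → (f.f n).hom x ∈ T'.S n) : T.quot ⟶ T'.quot where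
  f n := ModuleCat.ofHom (Submodule.mapQ _ _ (f.f n).hom (h n))
  comm' i j _ := by
    ext x
    obtain ⟨x, rfl⟩ := Submodule.Quotient.mk_surjective _ x
    exact congrArg (Submodule.Quotient.mk (p := T'.S j)) (cx_comm f i j x)

lemma hom_ext (T : SubCx K) {f g : T.quot ⟶ L}
    (h : ∀ n x, (f.f n).hom (T.cls x) = (g.f n).hom (T.cls x)) : f = g := by
  ext n x
  obtain ⟨x, rfl⟩ := T.cls_surjective x
  exact h n x

/-- The kernel of a chain map. -/
def ker (f : K ⟶ L) : SubCx K where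
  S n := LinearMap.ker (f.f n).hom
  d_mem i j x hx := by
    rw [LinearMap.mem_ker] at hx ⊢
    rw [← cx_comm, hx, map_zero]

end SubCx

/-- The product of two chain complexes. -/
def prodCx (K L : Cx R) : Cx R where
  X n := ModuleCat.of R (K.X n × L.X n)
  d i j := ModuleCat.ofHom (LinearMap.prodMap (K.d i j).hom (L.d i j).hom)
  shape i j h := by
    refine ModuleCat.hom_ext (LinearMap.ext fun x => Prod.ext ?_ ?_)
    · exact LinearMap.congr_fun (congrArg ModuleCat.Hom.hom (K.shape i j h)) x.1
    · exact LinearMap.congr_fun (congrArg ModuleCat.Hom.hom (L.shape i j h)) x.2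
  d_comp_d' i j k _ _ := by
    refine ModuleCat.hom_ext (LinearMap.ext fun x => Prod.ext ?_ ?_)
    · exact cx_d_d K i j k x.1
    · exact cx_d_d L i j k x.2

lemma prodCx_acyclic {K L : Cx R} (hK : K.Acyclic) (hL : L.Acyclic) : (prodCx K L).Acyclic := by
  rw [cx_acyclic_iff] at *
  intro n x hx
  obtain ⟨y, hy⟩ := hK n x.1 fun j => congrArg Prod.fst (hx j)
  obtain ⟨z, hz⟩ := hL n x.2 fun j => congrArg Prod.snd (hx j)
  exact ⟨(y, z), Prod.ext hy hz⟩

/-- A surjective chain map with acyclic kernel is an isomorphism in homology. -/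
lemma isIso_homologyMap_of_surjective {K L : Cx R} (f : K ⟶ L)
    (hf : ∀ n, Function.Surjective (f.f n).hom)
    (h : ∀ n (x : K.X n), (f.f n).hom x = 0 → (∀ j, (K.d n j).hom x = 0) →
      ∃ y : K.X (n + 1), (f.f (n + 1)).hom y = 0 ∧ (K.d (n + 1) n).hom y = x) (d : ℕ) :
    IsIso (HomologicalComplex.homologyMap f d) := by
  let S : ShortComplex (Cx R) := ShortComplex.mk (SubCx.ker f).ι f (by
    ext n x
    exact x.2)
  have hS : S.ShortExact := cx_shortExact (fun n => Subtype.val_injective) hf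
    fun n x hx => ⟨⟨x, hx⟩, rfl⟩
  have hac : (SubCx.ker f).sub.Acyclic := by
    rw [cx_acyclic_iff]
    intro n x hx
    obtain ⟨y, hy, hyx⟩ := h n x.1 x.2 fun j => congrArg Subtype.val (hx j)
    exact ⟨⟨y, hy⟩, Subtype.ext hyx⟩
  have hmono : Mono (HomologicalComplex.homologyMap f d) :=
    (hS.homology_exact₂ d).mono_g ((hac d).isZero_homology.eq_of_src _ _)
  have hepi : Epi (HomologicalComplex.homologyMap f d) := by
    rcases d with _ | d
    · have : Epi (f.f 0) := (ModuleCat.epi_iff_surjective _).2 (hf 0)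
      exact HomologicalComplex.epi_homologyMap_of_epi_of_not_rel _ _ (by simp)
    · exact (hS.homology_exact₃ (d + 1) d rfl).epi_f ((hac d).isZero_homology.eq_of_tgt _ _)
  exact isIso_of_mono_of_epi _

/-- An injective chain map with acyclic cokernel is an isomorphism in homology. -/
lemma isIso_homologyMap_of_injective {K L : Cx R} (f : K ⟶ L)
    (hf : ∀ n, Function.Injective (f.f n).hom)
    (h : ∀ n (x : L.X n), (∀ j, ∃ y, (f.f j).hom y = (L.d n j).hom x) →
      ∃ y z, (L.d (n + 1) n).hom y + (f.f n).hom z = x) (d : ℕ) :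
    IsIso (HomologicalComplex.homologyMap f d) := by
  let T : SubCx L := ⟨fun n => LinearMap.range (f.f n).hom, by
    rintro i j _ ⟨x, rfl⟩
    exact ⟨_, (cx_comm f i j x).symm⟩⟩
  let S : ShortComplex (Cx R) := ShortComplex.mk f T.π (by
    ext n x
    exact T.cls_eq_zero.2 ⟨x, rfl⟩)
  have hS : S.ShortExact := cx_shortExact hf (fun n => T.cls_surjective)
    fun n x hx => T.cls_eq_zero.1 hx
  have hac : T.quot.Acyclic := by
    rw [cx_acyclic_iff]
    intro n x hx
    obtain ⟨x, rfl⟩ := T.cls_surjective x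
    obtain ⟨y, z, hyz⟩ := h n x fun j => T.cls_eq_zero.1 (hx j)
    refine ⟨T.cls y, ?_⟩
    rw [T.d_cls, T.cls_eq]
    exact ⟨-z, by rw [map_neg, ← hyz]; abel⟩
  have hepi : Epi (HomologicalComplex.homologyMap f d) :=
    (hS.homology_exact₂ d).epi_f ((hac d).isZero_homology.eq_of_tgt _ _)
  have hmono : Mono (HomologicalComplex.homologyMap f d) :=
    (hS.homology_exact₁ (d + 1) d rfl).mono_g ((hac (d + 1)).isZero_homology.eq_of_src _ _)
  exact isIso_of_mono_of_epi _

/-- The linear map induced in homology. -/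
noncomputable abbrev hmap {K L : Cx R} (f : K ⟶ L) (d : ℕ) : K.homology d →ₗ[R] L.homology d :=
  (HomologicalComplex.homologyMap f d).hom

lemma hmap_comp {K L M : Cx R} (f : K ⟶ L) (g : L ⟶ M) (d : ℕ) (x : K.homology d) :
    hmap (f ≫ g) d x = hmap g d (hmap f d x) := by
  rw [hmap, HomologicalComplex.homologyMap_comp]
  rfl

lemma hmap_id (K : Cx R) (d : ℕ) (x : K.homology d) : hmap (𝟙 K) d x = x := by
  rw [hmap, HomologicalComplex.homologyMap_id]
  rfl

lemma hmap_neg {K L : Cx R} (f : K ⟶ L) (d : ℕ) (x : K.homology d) :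
    hmap (-f) d x = - hmap f d x := by
  rw [hmap, HomologicalComplex.homologyMap_neg]
  rfl

/-- An isomorphism in homology as a linear equivalence. -/
noncomputable def hequiv {K L : Cx R} (f : K ⟶ L) (d : ℕ)
    (_h : IsIso (HomologicalComplex.homologyMap f d)) : K.homology d ≃ₗ[R] L.homology d :=
  (asIso (HomologicalComplex.homologyMap f d)).toLinearEquiv

lemma hequiv_apply {K L : Cx R} (f : K ⟶ L) (d : ℕ)
    (h : IsIso (HomologicalComplex.homologyMap f d)) (x : K.homology d) :
    hequiv f d h x = hmap f d x := rfl

end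

section

variable {X Y Z : Type} [TopologicalSpace X] [TopologicalSpace Y] [TopologicalSpace Z]

/-- The subcomplex of singular chains supported in a subset. -/
noncomputable def chainsSub (A : Set X) : SubCx (singC.obj (TopCat.of X)) where
  S := chainsIn A
  d_mem i j x hx := by
    by_cases h : (ComplexShape.down ℕ).Rel i j
    · obtain rfl : j + 1 = i := h
      exact d_mem_chainsIn hx
    · rw [(singC.obj (TopCat.of X)).shape i j h]
      exact Submodule.zero_mem _

/-- The subcomplex of sums of singular chains supported in two subsets. -/
noncomputable def supSub (A B : Set X) : SubCx (singC.obj (TopCat.of X)) where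
  S n := chainsIn A n ⊔ chainsIn B n
  d_mem i j x hx := by
    obtain ⟨a, ha, b, hb, rfl⟩ := Submodule.mem_sup.1 hx
    rw [map_add]
    exact Submodule.add_mem_sup ((chainsSub A).d_mem i j a ha) ((chainsSub B).d_mem i j b hb)

lemma singSdHtpy_mem_sup {A B : Set X} {n : ℕ} {c : (singC.obj (TopCat.of X)).X n}
    (hc : c ∈ chainsIn A n ⊔ chainsIn B n) :
    singSdHtpy X n c ∈ chainsIn A (n + 1) ⊔ chainsIn B (n + 1) := by
  obtain ⟨a, ha, b, hb, rfl⟩ := Submodule.mem_sup.1 hc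
  rw [map_add]
  exact Submodule.add_mem_sup (singSdHtpy_mem_chainsIn ha) (singSdHtpy_mem_chainsIn hb)

lemma sub_singSd_sub_d_mem_sup {A B : Set X} {n : ℕ} {c : (singC.obj (TopCat.of X)).X n}
    (h : ∀ j, ((singC.obj (TopCat.of X)).d n j).hom c ∈ chainsIn A j ⊔ chainsIn B j) :
    c - singSd X n c - ((singC.obj (TopCat.of X)).d (n + 1) n).hom (singSdHtpy X n c) ∈
      chainsIn A n ⊔ chainsIn B n := by
  rcases n with _ | n
  · rw [d_singSdHtpy_zero, sub_self]
    exact Submodule.zero_mem _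
  · rw [d_singSdHtpy_succ, sub_sub_cancel]
    exact singSdHtpy_mem_sup (h n)

lemma exists_sub_d_mem_sup {A B : Set X} (hA : IsOpen A) (hB : IsOpen B) {n : ℕ}
    {c : (singC.obj (TopCat.of X)).X n} (hc : c ∈ chainsIn (A ∪ B) n)
    (h : ∀ j, ((singC.obj (TopCat.of X)).d n j).hom c ∈ chainsIn A j ⊔ chainsIn B j) :
    ∃ y ∈ chainsIn (A ∪ B) (n + 1),
      c - ((singC.obj (TopCat.of X)).d (n + 1) n).hom y ∈ chainsIn A n ⊔ chainsIn B n := by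
  obtain ⟨l, hl⟩ := exists_singSd_iterate_mem hA hB hc
  induction l generalizing c with
  | zero => exact ⟨0, Submodule.zero_mem _, by rw [map_zero, sub_zero]; exact hl⟩
  | succ l ih =>
    have key := sub_singSd_sub_d_mem_sup h
    obtain ⟨y, hy, hy'⟩ := ih (c := singSd X n c) (singSd_mem_chainsIn hc) (fun j => by
      have h1 := (supSub A B).d_mem n j _ key
      rw [map_sub, map_sub, cx_d_d, sub_zero] at h1
      exact (Submodule.sub_mem_iff_right _ (h j)).1 h1) (by
      rw [← Function.iterate_succ_apply]
      exact hl)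
    refine ⟨y + singSdHtpy X n c, Submodule.add_mem _ hy (singSdHtpy_mem_chainsIn hc), ?_⟩
    have := Submodule.add_mem _ hy' key
    rw [map_add]
    convert this using 1
    abel

/-- The singular chains of `X` relative to a subset. -/
noncomputable def relC (A : Set X) : Cx ℤ := (chainsSub A).quot

/-- The singular chain map of a continuous map. -/
noncomputable abbrev cmap (f : C(X, Y)) : singC.obj (TopCat.of X) ⟶ singC.obj (TopCat.of Y) :=
  singC.map (TopCat.ofHom f)

lemma cmap_comp (f : C(X, Y)) (g : C(Y, Z)) : cmap (g.comp f) = cmap f ≫ cmap g :=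
  singC.map_comp (TopCat.ofHom f) (TopCat.ofHom g)

lemma cmap_id : cmap (ContinuousMap.id X) = 𝟙 _ := singC.map_id (TopCat.of X)

lemma cmap_mem {A : Set X} {B : Set Y} (f : C(X, Y)) (h : Set.MapsTo f A B) (n : ℕ)
    (x : (singC.obj (TopCat.of X)).X n) (hx : x ∈ chainsIn A n) :
    ((cmap f).f n).hom x ∈ chainsIn B n := by
  refine chainsIn_le (S := (chainsIn B n).comap ((cmap f).f n).hom) (fun σ hσ => ?_) hx
  rw [Submodule.mem_comap, map_sbasis]
  exact sbasis_mem_chainsIn fun t => h (hσ t)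

/-- The map of relative singular chains of a continuous map of pairs. -/
noncomputable def relMap {A : Set X} {B : Set Y} (f : C(X, Y)) (h : Set.MapsTo f A B) :
    relC A ⟶ relC B :=
  (chainsSub A).mapQ (chainsSub B) (cmap f) (cmap_mem f h)

lemma relMap_comp {A : Set X} {B : Set Y} {C : Set Z} (f : C(X, Y)) (h : Set.MapsTo f A B)
    (g : C(Y, Z)) (h' : Set.MapsTo g B C) :
    relMap (g.comp f) (h'.comp h) = relMap f h ≫ relMap g h' := by
  refine (chainsSub A).hom_ext fun n x => ?_
  have : ((cmap (g.comp f)).f n).hom x = ((cmap g).f n).hom (((cmap f).f n).hom x) := by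
    rw [cmap_comp]
    rfl
  exact congrArg (chainsSub C).cls this

lemma hmap_congr_of_homotopic {f g : C(X, Y)} (h : f.Homotopic g) (d : ℕ) :
    hmap (cmap f) d = hmap (cmap g) d := by
  obtain ⟨H⟩ := h
  have H' : TopCat.Homotopy (X := TopCat.of X) (Y := TopCat.of Y)
    (TopCat.ofHom f) (TopCat.ofHom g) := H
  have := (SimplicialObject.Homotopy.toChainHomotopy
    ((H'.toSSet.toSimplicialObjectHomotopy).whiskerRight (ModuleCat.free ℤ))).homologyMap_eq d
  exact congrArg ModuleCat.Hom.hom this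

lemma isIso_hmap_of_homotopic (f : C(X, Y)) (g : C(Y, X))
    (h₁ : (g.comp f).Homotopic (ContinuousMap.id X)) (h₂ : (f.comp g).Homotopic (.id Y)) (d : ℕ) :
    IsIso (HomologicalComplex.homologyMap (cmap f) d) := by
  refine ⟨HomologicalComplex.homologyMap (cmap g) d, ?_, ?_⟩
  · have := hmap_congr_of_homotopic h₁ d
    rw [cmap_comp, cmap_id] at this
    rw [← HomologicalComplex.homologyMap_comp, ← HomologicalComplex.homologyMap_id]
    exact ModuleCat.hom_ext this
  · have := hmap_congr_of_homotopic h₂ d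
    rw [cmap_comp, cmap_id] at this
    rw [← HomologicalComplex.homologyMap_comp, ← HomologicalComplex.homologyMap_id]
    exact ModuleCat.hom_ext this

/-- The inclusion of a subset as a continuous map. -/
def incl (A : Set X) : C(A, X) := ⟨Subtype.val, continuous_subtype_val⟩

lemma cmap_eq (f : C(X, Y)) (n : ℕ) (x : (singC.obj (TopCat.of X)).X n) :
    ((cmap f).f n).hom x = (sbasis Y n).repr.symm
      (Finsupp.mapDomain (fun σ : C(stdSimplex ℝ (Fin (n + 1)), X) => f.comp σ)
        ((sbasis X n).repr x)) := by
  suffices h : ((cmap f).f n).hom = (sbasis Y n).repr.symm.toLinearMap ∘ₗ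
      Finsupp.lmapDomain ℤ ℤ (fun σ : C(stdSimplex ℝ (Fin (n + 1)), X) => f.comp σ) ∘ₗ
        (sbasis X n).repr.toLinearMap from LinearMap.congr_fun h x
  refine (sbasis X n).ext fun σ => ?_
  simp only [map_sbasis, LinearMap.comp_apply, LinearEquiv.coe_coe, Module.Basis.repr_self,
    Finsupp.lmapDomain_apply, Finsupp.mapDomain_single, Module.Basis.repr_symm_single_one]

lemma incl_comp_injective (A : Set X) (n : ℕ) : Function.Injective
    (fun σ : C(stdSimplex ℝ (Fin (n + 1)), A) => (incl A).comp σ) := fun _ _ h =>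
  ContinuousMap.ext fun t => Subtype.ext (DFunLike.congr_fun h t)

lemma cmap_incl_injective (A : Set X) (n : ℕ) :
    Function.Injective ((cmap (incl A)).f n).hom := by
  intro x y h
  rw [cmap_eq, cmap_eq] at h
  exact (sbasis A n).repr.injective (Finsupp.mapDomain_injective (incl_comp_injective A n)
    ((sbasis X n).repr.symm.injective h))

lemma cmap_incl_mem_iff (A U : Set X) (n : ℕ) (x : (singC.obj (TopCat.of A)).X n) :
    ((cmap (incl A)).f n).hom x ∈ chainsIn U n ↔ x ∈ chainsIn (incl A ⁻¹' U) n := by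
  classical
  refine ⟨fun h => ?_, fun h => cmap_mem (incl A) (fun _ h => h) n x h⟩
  rw [cmap_eq, chainsIn, Module.Basis.mem_span_image, LinearEquiv.apply_symm_apply] at h
  rw [chainsIn, Module.Basis.mem_span_image]
  intro σ hσ
  refine h (a := (incl A).comp σ) ?_
  rw [Finset.mem_coe, Finsupp.mem_support_iff,
    Finsupp.mapDomain_apply (incl_comp_injective A n)]
  exact Finsupp.mem_support_iff.1 hσ

lemma exists_cmap_incl_eq {A : Set X} {n : ℕ} {x : (singC.obj (TopCat.of X)).X n}
    (hx : x ∈ chainsIn A n) : ∃ y, ((cmap (incl A)).f n).hom y = x := by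
  refine chainsIn_le (S := LinearMap.range ((cmap (incl A)).f n).hom) (fun σ hσ => ?_) hx
  exact ⟨sbasis A n ⟨fun t => ⟨σ t, hσ t⟩, by fun_prop⟩, map_sbasis _ _ _⟩

lemma cmap_incl_mem (A : Set X) (n : ℕ) (x : (singC.obj (TopCat.of A)).X n) :
    ((cmap (incl A)).f n).hom x ∈ chainsIn A n := by
  refine cmap_mem (A := Set.univ) (incl A) (fun t _ => t.2) n x ?_
  rw [chainsIn]
  simp

/-- The short exact sequence of chain complexes of a pair. -/
noncomputable def pairSC (A : Set X) : ShortComplex (Cx ℤ) :=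
  ShortComplex.mk (X₂ := singC.obj (TopCat.of X)) (cmap (incl A)) (chainsSub A).π (by
    ext n x
    exact (chainsSub A).cls_eq_zero.2 (cmap_incl_mem A n x))

lemma pairSC_shortExact (A : Set X) : (pairSC A).ShortExact :=
  cx_shortExact (cmap_incl_injective A) (fun _ => (chainsSub A).cls_surjective)
    fun _ _ hx => exists_cmap_incl_eq ((chainsSub A).cls_eq_zero.1 hx)

lemma relC_acyclic_of_homotopic (A : Set X) (g : C(X, A))
    (h₁ : (g.comp (incl A)).Homotopic (.id A)) (h₂ : ((incl A).comp g).Homotopic (.id X)) :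
    (relC A).Acyclic := by
  have : QuasiIso (pairSC A).f := by
    rw [quasiIso_iff]
    intro d
    rw [quasiIsoAt_iff_isIso_homologyMap]
    exact isIso_hmap_of_homotopic _ g h₁ h₂ d
  exact (pairSC_shortExact A).acyclic_X₃ this

end

section

variable {R : Type} [CommRing R]

/-- Two endomorphisms are conjugate up to a scalar. -/
def TwConj {M M' : Type} [AddCommGroup M] [AddCommGroup M'] [Module R M] [Module R M'] (ε : R)
    (f : M →ₗ[R] M) (f' : M' →ₗ[R] M') : Prop :=
  ∃ e : M ≃ₗ[R] M', ∀ x, e (f x) = ε • f' (e x)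

lemma TwConj.refl {M : Type} [AddCommGroup M] [Module R M] (f : M →ₗ[R] M) :
    TwConj (1 : R) f f := ⟨LinearEquiv.refl _ _, fun _ => (one_smul _ _).symm⟩

lemma TwConj.of_eq {M M' : Type} [AddCommGroup M] [AddCommGroup M'] [Module R M] [Module R M']
    {ε ε' : R} {f : M →ₗ[R] M} {f' : M' →ₗ[R] M'} (h : TwConj ε f f') (he : ε = ε') :
    TwConj ε' f f' := he ▸ h

lemma TwConj.trans {M M' M'' : Type} [AddCommGroup M] [AddCommGroup M'] [AddCommGroup M'']
    [Module R M] [Module R M'] [Module R M''] {ε ε' : R}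
    {f : M →ₗ[R] M} {f' : M' →ₗ[R] M'} {f'' : M'' →ₗ[R] M''} (h : TwConj ε f f')
    (h' : TwConj ε' f' f'') : TwConj (ε * ε') f f'' := by
  obtain ⟨e, he⟩ := h
  obtain ⟨e', he'⟩ := h'
  refine ⟨e.trans e', fun x => ?_⟩
  rw [LinearEquiv.trans_apply, he, map_smul, he', smul_smul, LinearEquiv.trans_apply]

lemma TwConj.symm {M M' : Type} [AddCommGroup M] [AddCommGroup M'] [Module R M] [Module R M']
    {f : M →ₗ[R] M} {f' : M' →ₗ[R] M'} (h : TwConj 1 f f') : TwConj 1 f' f := by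
  obtain ⟨e, he⟩ := h
  refine ⟨e.symm, fun x => e.injective ?_⟩
  rw [map_smul, he, one_smul, one_smul, e.apply_symm_apply, e.apply_symm_apply]

lemma twConj_hmap {K L : Cx R} (g : K ⟶ L) (d : ℕ)
    (h : IsIso (HomologicalComplex.homologyMap g d)) (f : K ⟶ K) (f' : L ⟶ L)
    (hf : f ≫ g = g ≫ f') : TwConj (1 : R) (hmap f d) (hmap f' d) := by
  refine ⟨hequiv g d h, fun x => ?_⟩
  rw [hequiv_apply, hequiv_apply, ← hmap_comp, hf, hmap_comp, one_smul]

namespace SubCx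

variable {K : Cx R}

/-- The projection of quotients for nested subcomplexes. -/
def proj (T T' : SubCx K) (h : ∀ n, T.S n ≤ T'.S n) : T.quot ⟶ T'.quot :=
  T.mapQ T' (𝟙 K) h

/-- The antidiagonal map of quotients. -/
def mvF (I A B : SubCx K) (hA : ∀ n, I.S n ≤ A.S n) (hB : ∀ n, I.S n ≤ B.S n) :
    I.quot ⟶ prodCx A.quot B.quot where
  f n := ModuleCat.ofHom (LinearMap.prod ((I.proj A hA).f n).hom (-((I.proj B hB).f n).hom))
  comm' i j _ := by
    refine ModuleCat.hom_ext (LinearMap.ext fun x => ?_)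
    obtain ⟨x, rfl⟩ := I.cls_surjective x
    exact Prod.ext rfl (map_neg (B.quot.d i j).hom (B.cls x))

/-- The sum map of quotients. -/
def mvG (A B U : SubCx K) (hA : ∀ n, A.S n ≤ U.S n) (hB : ∀ n, B.S n ≤ U.S n) :
    prodCx A.quot B.quot ⟶ U.quot where
  f n := ModuleCat.ofHom (LinearMap.coprod ((A.proj U hA).f n).hom ((B.proj U hB).f n).hom)
  comm' i j _ := by
    refine ModuleCat.hom_ext (LinearMap.ext fun x => ?_)
    obtain ⟨a, b⟩ := x
    obtain ⟨x, rfl⟩ := A.cls_surjective a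
    obtain ⟨y, rfl⟩ := B.cls_surjective b
    exact congrArg U.cls (map_add (K.d i j).hom x y)

variable {I A B U : SubCx K} (hI : ∀ n, I.S n = A.S n ⊓ B.S n)
  (hU : ∀ n, U.S n = A.S n ⊔ B.S n)

/-- The Mayer–Vietoris sequence of two subcomplexes. -/
def mvSC (I A B U : SubCx K) (hI : ∀ n, I.S n = A.S n ⊓ B.S n)
    (hU : ∀ n, U.S n = A.S n ⊔ B.S n) :
    ShortComplex (Cx R) :=
  ShortComplex.mk
    (mvF I A B (fun n => (hI n).trans_le inf_le_left) fun n => (hI n).trans_le inf_le_right)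
    (mvG A B U (fun n => le_sup_left.trans_eq (hU n).symm)
      fun n => le_sup_right.trans_eq (hU n).symm)
    (I.hom_ext fun _ x => congrArg U.cls (add_neg_cancel x))

lemma mvSC_shortExact : (mvSC I A B U hI hU).ShortExact := by
  refine cx_shortExact (fun n => ?_) (fun n z => ?_)
    (fun n (z : A.quot.X n × B.quot.X n) hz => ?_)
  · refine (injective_iff_map_eq_zero ((mvF I A B (fun n => (hI n).trans_le inf_le_left)
      fun n => (hI n).trans_le inf_le_right).f n).hom).2 fun z hz => ?_
    obtain ⟨x, rfl⟩ := I.cls_surjective z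
    have h1 := A.cls_eq_zero.1 (congrArg Prod.fst hz)
    have h2 := B.cls_eq_zero.1 (neg_eq_zero.1 (congrArg Prod.snd hz))
    rw [I.cls_eq_zero, hI]
    exact ⟨h1, h2⟩
  · obtain ⟨x, rfl⟩ := U.cls_surjective (n := n) z
    exact ⟨(A.cls x, B.cls 0), congrArg U.cls (add_zero x)⟩
  · obtain ⟨a, b⟩ := z
    obtain ⟨x, rfl⟩ := A.cls_surjective a
    obtain ⟨y, rfl⟩ := B.cls_surjective b
    have hz' : x + y ∈ U.S n := U.cls_eq_zero.1 hz
    rw [hU] at hz'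
    obtain ⟨a, ha, b, hb, hab⟩ := Submodule.mem_sup.1 hz'
    refine ⟨I.cls (x - a), Prod.ext ((A.cls_eq (x := x - a) (y := x)).2 ?_)
      ((B.cls_eq (x := -(x - a)) (y := y)).2 ?_)⟩
    · rw [sub_sub_cancel_left]
      exact Submodule.neg_mem _ ha
    · have : -(x - a) - y = -b := by
        rw [eq_neg_iff_add_eq_zero, ← sub_eq_zero.2 hab]
        abel
      rw [this]
      exact Submodule.neg_mem _ hb

include hI hU in
lemma subsingleton_homology_zero_sup (hA : A.quot.Acyclic) (hB : B.quot.Acyclic) :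
    Subsingleton (U.quot.homology 0) := by
  have hS := mvSC_shortExact hI hU
  have : Epi (mvSC I A B U hI hU).g := hS.epi_g
  have h1 : Epi (HomologicalComplex.homologyMap (mvSC I A B U hI hU).g 0) :=
    HomologicalComplex.epi_homologyMap_of_epi_of_not_rel _ _ (by simp)
  have h2 : Limits.IsZero ((mvSC I A B U hI hU).X₂.homology 0) :=
    ((prodCx_acyclic hA hB) 0).isZero_homology
  exact ModuleCat.subsingleton_of_isZero (@Limits.IsZero.of_epi _ _ _ _ _ _ h1 h2)

lemma twConj_mv (hA : A.quot.Acyclic) (hB : B.quot.Acyclic) (d : ℕ) (ε : R)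
    (φ : mvSC I A B U hI hU ⟶ mvSC I A B U hI hU) (ψ : I.quot ⟶ I.quot)
    (h : ∀ x, hmap φ.τ₁ d x = ε • hmap ψ d x) :
    TwConj ε (hmap φ.τ₃ (d + 1)) (hmap ψ d) := by
  have hS := mvSC_shortExact hI hU
  have hac := prodCx_acyclic hA hB
  have hiso : IsIso (hS.δ (d + 1) d rfl) := hS.isIso_δ _ _ _ (hac _).isZero_homology
    (hac _).isZero_homology
  refine ⟨(asIso (hS.δ (d + 1) d rfl)).toLinearEquiv, fun x => ?_⟩
  have := HomologicalComplex.HomologySequence.δ_naturality φ hS hS (d + 1) d rfl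
  refine (LinearMap.congr_fun (congrArg ModuleCat.Hom.hom this) x).symm.trans ?_
  exact h _

include hI hU in
lemma twConj_mv_of_mapsTo (hA : A.quot.Acyclic) (hB : B.quot.Acyclic) (d : ℕ)
    (f : K ⟶ K) (fA : ∀ n x, x ∈ A.S n → (f.f n).hom x ∈ A.S n)
    (fB : ∀ n x, x ∈ B.S n → (f.f n).hom x ∈ B.S n)
    (fI : ∀ n x, x ∈ I.S n → (f.f n).hom x ∈ I.S n)
    (fU : ∀ n x, x ∈ U.S n → (f.f n).hom x ∈ U.S n) :
    TwConj (1 : R) (hmap (U.mapQ U f fU) (d + 1)) (hmap (I.mapQ I f fI) d) := by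
  let τ₂ : prodCx A.quot B.quot ⟶ prodCx A.quot B.quot := {
    f := fun n => ModuleCat.ofHom (LinearMap.prodMap ((A.mapQ A f fA).f n).hom
      ((B.mapQ B f fB).f n).hom)
    comm' := fun i j _ => ModuleCat.hom_ext (LinearMap.ext fun x =>
      Prod.ext (cx_comm (A.mapQ A f fA) i j x.1) (cx_comm (B.mapQ B f fB) i j x.2)) }
  refine twConj_mv hI hU hA hB d 1 ⟨I.mapQ I f fI, τ₂, U.mapQ U f fU, ?_, ?_⟩ _
    fun x => (one_smul _ _).symm
  · refine I.hom_ext fun n x => Prod.ext rfl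
      (map_neg ((B.mapQ B f fB).f n).hom (B.cls x)).symm
  · ext n z
    obtain ⟨a, b⟩ := z
    obtain ⟨x, rfl⟩ := A.cls_surjective a
    obtain ⟨y, rfl⟩ := B.cls_surjective b
    exact congrArg U.cls (map_add (f.f n).hom x y).symm

include hI hU in
lemma twConj_mv_of_swap (hA : A.quot.Acyclic) (hB : B.quot.Acyclic) (d : ℕ)
    (f : K ⟶ K) (fA : ∀ n x, x ∈ A.S n → (f.f n).hom x ∈ B.S n)
    (fB : ∀ n x, x ∈ B.S n → (f.f n).hom x ∈ A.S n)
    (fI : ∀ n x, x ∈ I.S n → (f.f n).hom x ∈ I.S n)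
    (fU : ∀ n x, x ∈ U.S n → (f.f n).hom x ∈ U.S n) :
    TwConj (-1 : R) (hmap (U.mapQ U f fU) (d + 1)) (hmap (I.mapQ I f fI) d) := by
  let τ₂ : prodCx A.quot B.quot ⟶ prodCx A.quot B.quot := {
    f := fun n => ModuleCat.ofHom (LinearMap.prod
      (((B.mapQ A f fB).f n).hom ∘ₗ LinearMap.snd R _ _)
      (((A.mapQ B f fA).f n).hom ∘ₗ LinearMap.fst R _ _))
    comm' := fun i j _ => ModuleCat.hom_ext (LinearMap.ext fun x =>
      Prod.ext (cx_comm (B.mapQ A f fB) i j x.2) (cx_comm (A.mapQ B f fA) i j x.1)) }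
  refine twConj_mv hI hU hA hB d (-1) ⟨-I.mapQ I f fI, τ₂, U.mapQ U f fU, ?_, ?_⟩
    (I.mapQ I f fI) fun x => ?_
  · refine I.hom_ext fun n x => Prod.ext ?_ ?_
    · exact congrArg A.cls (map_neg (f.f n).hom x).symm
    · exact neg_neg (B.cls ((f.f n).hom x))
  · ext n z
    obtain ⟨a, b⟩ := z
    obtain ⟨x, rfl⟩ := A.cls_surjective a
    obtain ⟨y, rfl⟩ := B.cls_surjective b
    exact congrArg U.cls ((add_comm _ _).trans (map_add (f.f n).hom x y).symm)
  · exact (hmap_neg (I.mapQ I f fI) d x).trans (neg_one_smul R _).symm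

end SubCx

end

section

variable {X Y Z : Type} [TopologicalSpace X] [TopologicalSpace Y] [TopologicalSpace Z]

lemma supSub_le (A B : Set X) (n : ℕ) : (supSub A B).S n ≤ (chainsSub (A ∪ B)).S n :=
  sup_le (chainsIn_mono Set.subset_union_left n) (chainsIn_mono Set.subset_union_right n)

lemma isIso_supSub_proj {A B : Set X} (hA : IsOpen A) (hB : IsOpen B) (d : ℕ) :
    IsIso (HomologicalComplex.homologyMap
      ((supSub A B).proj (chainsSub (A ∪ B)) (supSub_le A B)) d) := by
  refine isIso_homologyMap_of_surjective _ (fun n x => ?_) (fun n x hx hd => ?_) d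
  · obtain ⟨x, rfl⟩ := (chainsSub (A ∪ B)).cls_surjective x
    exact ⟨(supSub A B).cls x, rfl⟩
  · obtain ⟨c, rfl⟩ := (supSub A B).cls_surjective x
    obtain ⟨y, hy, hy'⟩ := exists_sub_d_mem_sup hA hB ((chainsSub (A ∪ B)).cls_eq_zero.1 hx)
      fun j => (supSub A B).cls_eq_zero.1 (hd j)
    refine ⟨(supSub A B).cls y, (chainsSub (A ∪ B)).cls_eq_zero.2 hy, ?_⟩
    rw [SubCx.d_cls]
    refine ((supSub A B).cls_eq.2 ?_).symm
    exact hy'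

lemma supSub_mem {A B A' B' : Set X} (f : C(X, X)) (hA : Set.MapsTo f A A')
    (hB : Set.MapsTo f B B') (n : ℕ) (x : (singC.obj (TopCat.of X)).X n)
    (hx : x ∈ (supSub A B).S n) : ((cmap f).f n).hom x ∈ (supSub A' B').S n := by
  obtain ⟨a, ha, b, hb, rfl⟩ := Submodule.mem_sup.1 hx
  rw [map_add]
  exact Submodule.add_mem_sup (cmap_mem f hA n a ha) (cmap_mem f hB n b hb)

lemma subsingleton_relC_union {A B : Set X} (hA : IsOpen A) (hB : IsOpen B)
    (hA' : (relC A).Acyclic) (hB' : (relC B).Acyclic) :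
    Subsingleton ((relC (A ∪ B)).homology 0) :=
  have := SubCx.subsingleton_homology_zero_sup (I := chainsSub (A ∩ B)) (A := chainsSub A)
    (B := chainsSub B) (U := supSub A B)
    (chainsIn_inter A B) (fun _ => rfl) hA' hB'
  (hequiv _ 0 (isIso_supSub_proj hA hB 0)).symm.toEquiv.subsingleton

lemma twConj_relC_union {A B : Set X} (hA : IsOpen A) (hB : IsOpen B)
    (hA' : (relC A).Acyclic) (hB' : (relC B).Acyclic) (f : C(X, X))
    (fA : Set.MapsTo f A A) (fB : Set.MapsTo f B B) (fI : Set.MapsTo f (A ∩ B) (A ∩ B))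
    (fU : Set.MapsTo f (A ∪ B) (A ∪ B)) (d : ℕ) :
    TwConj (1 : ℤ) (hmap (relMap f fU) (d + 1)) (hmap (relMap f fI) d) := by
  have h := SubCx.twConj_mv_of_mapsTo (I := chainsSub (A ∩ B)) (A := chainsSub A)
    (B := chainsSub B) (U := supSub A B)
    (chainsIn_inter A B) (fun _ => rfl) hA' hB' d (cmap f) (cmap_mem f fA) (cmap_mem f fB)
    (cmap_mem f fI) (supSub_mem f fA fB)
  have h' := twConj_hmap _ (d + 1) (isIso_supSub_proj hA hB (d + 1))
    ((supSub A B).mapQ (supSub A B) (cmap f) (supSub_mem f fA fB)) (relMap f fU)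
    ((supSub A B).hom_ext fun n x => rfl)
  exact h'.symm.trans h

lemma twConj_relC_union_of_swap {A B : Set X} (hA : IsOpen A) (hB : IsOpen B)
    (hA' : (relC A).Acyclic) (hB' : (relC B).Acyclic) (f : C(X, X))
    (fA : Set.MapsTo f A B) (fB : Set.MapsTo f B A) (fI : Set.MapsTo f (A ∩ B) (A ∩ B))
    (fU : Set.MapsTo f (A ∪ B) (A ∪ B)) (d : ℕ) :
    TwConj (-1 : ℤ) (hmap (relMap f fU) (d + 1)) (hmap (relMap f fI) d) := by
  have hf : ∀ n x, x ∈ (supSub A B).S n → ((cmap f).f n).hom x ∈ (supSub A B).S n :=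
    fun n x hx => (sup_comm (chainsIn B n) (chainsIn A n)).le (supSub_mem f fA fB n x hx)
  have h := SubCx.twConj_mv_of_swap (I := chainsSub (A ∩ B)) (A := chainsSub A)
    (B := chainsSub B) (U := supSub A B)
    (chainsIn_inter A B) (fun _ => rfl) hA' hB' d (cmap f) (cmap_mem f fA) (cmap_mem f fB)
    (cmap_mem f fI) hf
  have h' := twConj_hmap _ (d + 1) (isIso_supSub_proj hA hB (d + 1))
    ((supSub A B).mapQ (supSub A B) (cmap f) hf) (relMap f fU)
    ((supSub A B).hom_ext fun n x => rfl)
  exact h'.symm.trans h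

lemma chainsIn_univ (n : ℕ) : chainsIn (Set.univ : Set X) n = ⊤ := by
  rw [chainsIn]
  simp

lemma chainsIn_empty (n : ℕ) : chainsIn (∅ : Set X) n = ⊥ := by
  refine eq_bot_iff.2 (chainsIn_le fun σ hσ => ?_)
  exact (hσ (Classical.arbitrary _)).elim

lemma isIso_chainsSub_empty_π (d : ℕ) :
    IsIso (HomologicalComplex.homologyMap (chainsSub (∅ : Set X)).π d) := by
  refine isIso_homologyMap_of_surjective _ (fun n => (chainsSub (∅ : Set X)).cls_surjective)
    (fun n x hx _ => ?_) d
  have h : x ∈ chainsIn (∅ : Set X) n := (chainsSub (∅ : Set X)).cls_eq_zero.1 hx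
  rw [chainsIn_empty, Submodule.mem_bot] at h
  exact ⟨0, map_zero _, by rw [h, map_zero]⟩

lemma twConj_relC_empty (f : C(X, X)) (hf : Set.MapsTo f (∅ : Set X) ∅) (d : ℕ) :
    TwConj (1 : ℤ) (hmap (relMap f hf) d) (hmap (cmap f) d) :=
  (twConj_hmap _ d (isIso_chainsSub_empty_π d) (cmap f) (relMap f hf) rfl).symm

lemma isIso_excision {V U : Set X} (hV : IsOpen V) (hU : IsOpen U) (h : V ∪ U = Set.univ) (d : ℕ) :
    IsIso (HomologicalComplex.homologyMap
      (relMap (A := incl V ⁻¹' U) (incl V) fun _ h => h) d) := by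
  refine isIso_homologyMap_of_injective _ (fun n => ?_) (fun n x hx => ?_) d
  · refine (injective_iff_map_eq_zero ((relMap (A := incl V ⁻¹' U) (B := U) (incl V)
      fun _ h => h).f n).hom).2 fun z hz => ?_
    obtain ⟨x, rfl⟩ := (chainsSub (incl V ⁻¹' U)).cls_surjective z
    exact (chainsSub _).cls_eq_zero.2 ((cmap_incl_mem_iff V U n x).1
      ((chainsSub U).cls_eq_zero.1 hz))
  · obtain ⟨c, rfl⟩ := (chainsSub U).cls_surjective x
    obtain ⟨y, -, hy'⟩ := exists_sub_d_mem_sup hV hU (c := c)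
      (by rw [h, chainsIn_univ]; trivial) fun j => by
        obtain ⟨z, hz⟩ := hx j
        obtain ⟨z, rfl⟩ := (chainsSub (incl V ⁻¹' U)).cls_surjective z
        have h1 : ((cmap (incl V)).f j).hom z - ((singC.obj (TopCat.of X)).d n j).hom c ∈
          chainsIn U j := (chainsSub U).cls_eq.1 hz
        rw [← sub_sub_cancel (((cmap (incl V)).f j).hom z)
          (((singC.obj (TopCat.of X)).d n j).hom c)]
        exact Submodule.sub_mem _ (Submodule.mem_sup_left (cmap_incl_mem V j z))
          (Submodule.mem_sup_right h1)
    obtain ⟨a, ha, b, hb, hab⟩ := Submodule.mem_sup.1 hy'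
    obtain ⟨z, rfl⟩ := exists_cmap_incl_eq ha
    refine ⟨(chainsSub U).cls y, (chainsSub (incl V ⁻¹' U)).cls z, ?_⟩
    refine ((chainsSub U).cls_eq (x := ((singC.obj (TopCat.of X)).d (n + 1) n).hom y +
      ((cmap (incl V)).f n).hom z) (y := c)).2 ?_
    have : ((singC.obj (TopCat.of X)).d (n + 1) n).hom y +
      ((cmap (incl V)).f n).hom z - c = -b := by
        rw [eq_neg_iff_add_eq_zero, sub_add_eq_add_sub, add_assoc, hab]
        abel
    rw [this]
    exact Submodule.neg_mem _ hb

lemma relC_acyclic_of_deformation (A : Set X) (H : C(unitInterval × X, X))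
    (h0 : ∀ x, H (0, x) ∈ A) (h1 : ∀ x, H (1, x) = x) (hA : ∀ t, ∀ x ∈ A, H (t, x) ∈ A) :
    (relC A).Acyclic := by
  refine relC_acyclic_of_homotopic A ⟨fun x => ⟨H (0, x), h0 x⟩, by fun_prop⟩ ?_ ?_
  · refine ⟨⟨⟨fun p => ⟨H (p.1, p.2.1), hA _ _ p.2.2⟩, by fun_prop⟩, fun x => rfl, fun x => ?_⟩⟩
    exact Subtype.ext (h1 x)
  · exact ⟨⟨H, fun x => rfl, fun x => h1 x⟩⟩

end

section

variable {X Y Z : Type} [TopologicalSpace X] [TopologicalSpace Y] [TopologicalSpace Z]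

/-- The singular chain complex of a point. -/
noncomputable def singCPointIso : singC.obj (TopCat.of PUnit) ≅
    ChainComplex.alternatingConst.obj ((ModuleCat.free ℤ).obj PUnit) :=
  (AlgebraicTopology.alternatingFaceMapComplex _).mapIso
    (((SimplicialObject.whiskering _ _).obj (ModuleCat.free ℤ)).mapIso
      (TopCat.toSSetIsoConst (TopCat.of PUnit)) ≪≫ Functor.constComp _ _ _) ≪≫
    AlgebraicTopology.alternatingFaceMapComplexConst.app _

/-- The zeroth homology of a point. -/
noncomputable def singCPointHomologyZero :
    (singC.obj (TopCat.of PUnit)).homology 0 ≃ₗ[ℤ] (PUnit →₀ ℤ) :=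
  ((HomologicalComplex.homologyFunctor _ _ 0).mapIso singCPointIso ≪≫
    ChainComplex.alternatingConstHomologyZero _).toLinearEquiv

lemma subsingleton_singC_point {d : ℕ} (hd : d ≠ 0) :
    Subsingleton ((singC.obj (TopCat.of PUnit)).homology d) :=
  ModuleCat.subsingleton_of_isZero (HomologicalComplex.ExactAt.of_iso
    (ChainComplex.alternatingConst_exactAt _ d hd) singCPointIso.symm).isZero_homology

lemma isIso_hmap_of_contractible [ContractibleSpace X] (d : ℕ) :
    IsIso (HomologicalComplex.homologyMap
      (cmap (ContinuousMap.const X PUnit.unit : C(X, PUnit))) d) := by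
  obtain ⟨e⟩ := ContractibleSpace.hequiv_unit X
  exact isIso_hmap_of_homotopic _ e.invFun e.left_inv e.right_inv d

lemma hmap_cmap_of_contractible [ContractibleSpace X] (f : C(X, X)) (d : ℕ)
    (x : (singC.obj (TopCat.of X)).homology d) : hmap (cmap f) d x = x := by
  apply (hequiv _ d (isIso_hmap_of_contractible (X := X) d)).injective
  rw [hequiv_apply, hequiv_apply, ← hmap_comp, ← cmap_comp]

/-- The set of points with a nonzero coordinate of index less than `k`. -/
def nonzeroBelow (Z : Type) (N k : ℕ) : Set (Z × (Fin N → ℝ)) :=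
  {p | ∃ i : Fin N, i.1 < k ∧ p.2 i ≠ 0}

/-- The union of `nonzeroBelow` and an open half space. -/
def halfBelow (Z : Type) (N k : ℕ) (s : ℝ) : Set (Z × (Fin N → ℝ)) :=
  {p | ∃ i : Fin N, (i.1 < k ∧ p.2 i ≠ 0) ∨ (i.1 = k ∧ 0 < s * p.2 i)}

lemma isOpen_halfBelow (N k : ℕ) (s : ℝ) : IsOpen (halfBelow Z N k s) := by
  simp only [halfBelow, Set.ofPred_exists]
  refine isOpen_iUnion fun i => IsOpen.union (IsOpen.and isOpen_const ?_)
    (IsOpen.and isOpen_const ?_)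
  · exact isOpen_ne_fun (by fun_prop) (by fun_prop)
  · exact isOpen_lt (by fun_prop) (by fun_prop)

omit [TopologicalSpace Z] in
lemma nonzeroBelow_eq_inter (N k : ℕ) :
    nonzeroBelow Z N k = halfBelow Z N k 1 ∩ halfBelow Z N k (-1) := by
  ext p
  constructor
  · rintro ⟨i, hi⟩
    exact ⟨⟨i, .inl hi⟩, ⟨i, .inl hi⟩⟩
  · rintro ⟨⟨i, hi | hi⟩, ⟨j, hj | hj⟩⟩
    · exact ⟨i, hi⟩
    · exact ⟨i, hi⟩
    · exact ⟨j, hj⟩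
    · obtain rfl : i = j := Fin.ext (hi.1.trans hj.1.symm)
      linarith [hi.2, hj.2]

omit [TopologicalSpace Z] in
lemma nonzeroBelow_succ_eq_union (N k : ℕ) :
    nonzeroBelow Z N (k + 1) = halfBelow Z N k 1 ∪ halfBelow Z N k (-1) := by
  ext p
  constructor
  · rintro ⟨i, hi, hi'⟩
    rcases Nat.lt_succ_iff_lt_or_eq.1 hi with h | h
    · exact .inl ⟨i, .inl ⟨h, hi'⟩⟩
    · rcases lt_or_gt_of_ne hi' with h' | h'
      · exact .inr ⟨i, .inr ⟨h, by linarith⟩⟩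
      · exact .inl ⟨i, .inr ⟨h, by linarith⟩⟩
  · rintro (⟨i, hi | hi⟩ | ⟨i, hi | hi⟩)
    · exact ⟨i, by omega, hi.2⟩
    · exact ⟨i, by omega, fun h => by simp [h] at hi⟩
    · exact ⟨i, by omega, hi.2⟩
    · exact ⟨i, by omega, fun h => by simp [h] at hi⟩

lemma relC_halfBelow_acyclic {N k : ℕ} (hk : k < N) {s : ℝ} (hs : s * s = 1) :
    (relC (halfBelow Z N k s)).Acyclic := by
  have hc : ∀ i : Fin N, Continuous fun p : unitInterval × (Z × (Fin N → ℝ)) =>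
      if i.1 = k then (1 - (p.1 : ℝ)) * (s * (|p.2.2 i| + 1)) + p.1 * p.2.2 i else p.2.2 i := by
    intro i
    split_ifs <;> fun_prop
  refine relC_acyclic_of_deformation _ ⟨fun p => (p.2.1, fun i =>
      if i.1 = k then (1 - (p.1 : ℝ)) * (s * (|p.2.2 i| + 1)) + p.1 * p.2.2 i else p.2.2 i),
      by fun_prop⟩ (fun x => ?_) (fun x => ?_) fun t x hx => ?_
  · refine ⟨⟨k, hk⟩, .inr ⟨rfl, ?_⟩⟩
    simp only [ContinuousMap.coe_mk, if_true, Set.Icc.coe_zero, sub_zero, one_mul, zero_mul,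
      add_zero, ← mul_assoc, hs]
    positivity
  · refine Prod.ext rfl (funext fun i => ?_)
    simp
  · obtain ⟨i, ⟨hi, hi'⟩ | ⟨hi, hi'⟩⟩ := hx
    · refine ⟨i, .inl ⟨hi, ?_⟩⟩
      simpa [hi.ne] using hi'
    · refine ⟨i, .inr ⟨hi, ?_⟩⟩
      simp only [ContinuousMap.coe_mk, hi, if_true]
      have h1 : s * ((1 - (t : ℝ)) * (s * (|x.2 i| + 1)) + t * x.2 i) =
        (1 - (t : ℝ)) * (|x.2 i| + 1) + t * (s * x.2 i) := by
          linear_combination (1 - (t : ℝ)) * (|x.2 i| + 1) * hs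
      rw [h1]
      rcases eq_or_lt_of_le t.2.1 with h | h
      · rw [← h]
        have := abs_nonneg (x.2 i)
        linarith
      · have := mul_pos h hi'
        have := mul_nonneg (sub_nonneg.2 t.2.2) (add_nonneg (abs_nonneg (x.2 i)) zero_le_one)
        linarith

/-- The map of a product with a Euclidean space which reverses the first coordinate. -/
def flipMap (N : ℕ) (r : C(Z, Z)) : C(Z × (Fin N → ℝ), Z × (Fin N → ℝ)) :=
  ⟨fun p => (r p.1, fun i => if i.1 = 0 then - p.2 i else p.2 i), by
    have hc : ∀ i : Fin N, Continuous fun p : Z × (Fin N → ℝ) =>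
      if i.1 = 0 then - p.2 i else p.2 i := by
      intro i
      split_ifs <;> fun_prop
    fun_prop⟩

lemma flipMap_mapsTo (N k : ℕ) (r : C(Z, Z)) :
    Set.MapsTo (flipMap N r) (nonzeroBelow Z N k) (nonzeroBelow Z N k) := by
  rintro p ⟨i, hi, hi'⟩
  refine ⟨i, hi, ?_⟩
  simp only [flipMap, ContinuousMap.coe_mk]
  split_ifs
  · exact neg_ne_zero.2 hi'
  · exact hi'

lemma flipMap_mapsTo_half_zero (N : ℕ) (r : C(Z, Z)) (s : ℝ) :
    Set.MapsTo (flipMap N r) (halfBelow Z N 0 s) (halfBelow Z N 0 (-s)) := by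
  rintro p ⟨i, ⟨hi, -⟩ | ⟨hi, hi'⟩⟩
  · simp at hi
  · refine ⟨i, .inr ⟨hi, ?_⟩⟩
    simpa [flipMap, hi] using hi'

lemma flipMap_mapsTo_half_succ (N k : ℕ) (r : C(Z, Z)) (s : ℝ) :
    Set.MapsTo (flipMap N r) (halfBelow Z N (k + 1) s) (halfBelow Z N (k + 1) s) := by
  rintro p ⟨i, ⟨hi, hi'⟩ | ⟨hi, hi'⟩⟩
  · refine ⟨i, .inl ⟨hi, ?_⟩⟩
    simp only [flipMap, ContinuousMap.coe_mk]
    split_ifs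
    · exact neg_ne_zero.2 hi'
    · exact hi'
  · refine ⟨i, .inr ⟨hi, ?_⟩⟩
    simpa [flipMap, hi] using hi'

lemma twConj_congr_set {A B : Set X} (h : A = B) (f : C(X, X)) (hA : Set.MapsTo f A A)
    (hB : Set.MapsTo f B B) (d : ℕ) :
    TwConj (1 : ℤ) (hmap (relMap f hA) d) (hmap (relMap f hB) d) := by
  subst h
  exact .refl _

lemma twConj_flipMap_succ {N k : ℕ} (hk : k < N) (r : C(Z, Z)) (d : ℕ) :
    TwConj (if k = 0 then -1 else 1 : ℤ)
      (hmap (relMap (flipMap N r) (flipMap_mapsTo N (k + 1) r)) (d + 1))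
      (hmap (relMap (flipMap N r) (flipMap_mapsTo N k r)) d) := by
  have fI := flipMap_mapsTo N k r
  have fU := flipMap_mapsTo N (k + 1) r
  have h1 := twConj_congr_set (nonzeroBelow_succ_eq_union N k) (flipMap N r) fU
    (by rwa [← nonzeroBelow_succ_eq_union]) (d + 1)
  have h2 := twConj_congr_set (nonzeroBelow_eq_inter N k) (flipMap N r) fI
    (by rwa [← nonzeroBelow_eq_inter]) d
  have o1 := isOpen_halfBelow (Z := Z) N k 1
  have o2 := isOpen_halfBelow (Z := Z) N k (-1)
  have a1 := relC_halfBelow_acyclic (Z := Z) hk (s := 1) (by norm_num)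
  have a2 := relC_halfBelow_acyclic (Z := Z) hk (s := -1) (by norm_num)
  rcases k with _ | k
  · have g1 := flipMap_mapsTo_half_zero N r 1
    have g2 := flipMap_mapsTo_half_zero N r (-1)
    rw [neg_neg] at g2
    exact TwConj.of_eq ((h1.trans (twConj_relC_union_of_swap o1 o2 a1 a2 _ g1 g2 _ _ d)).trans
      h2.symm) (by simp)
  · exact TwConj.of_eq ((h1.trans (twConj_relC_union o1 o2 a1 a2 _
      (flipMap_mapsTo_half_succ N k r 1) (flipMap_mapsTo_half_succ N k r (-1)) _ _ d)).trans
      h2.symm) (by simp)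

lemma subsingleton_nonzeroBelow_succ_zero {N k : ℕ} (hk : k < N) :
    Subsingleton ((relC (nonzeroBelow Z N (k + 1))).homology 0) := by
  rw [nonzeroBelow_succ_eq_union]
  exact subsingleton_relC_union (isOpen_halfBelow N k 1) (isOpen_halfBelow N k (-1))
    (relC_halfBelow_acyclic hk (by norm_num)) (relC_halfBelow_acyclic hk (by norm_num))

lemma subsingleton_nonzeroBelow {N k d : ℕ} (hk : k ≤ N) (hd : d < k) :
    Subsingleton ((relC (nonzeroBelow Z N k)).homology d) := by
  induction k generalizing d with
  | zero => simp at hd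
  | succ k ih =>
    rcases d with _ | d
    · exact subsingleton_nonzeroBelow_succ_zero hk
    · obtain ⟨e, -⟩ := twConj_flipMap_succ (Z := Z) hk (ContinuousMap.id Z) d
      have := ih (by omega) (Nat.lt_of_succ_lt_succ hd)
      exact e.toEquiv.subsingleton

omit [TopologicalSpace Z] in
lemma nonzeroBelow_zero (N : ℕ) : nonzeroBelow Z N 0 = ∅ := by
  ext
  simp [nonzeroBelow]

lemma twConj_flipMap_proj (N : ℕ) (r : C(Z, Z)) (d : ℕ) :
    TwConj (1 : ℤ) (hmap (cmap (flipMap N r)) d) (hmap (cmap r) d) := by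
  refine twConj_hmap (cmap (ContinuousMap.fst : C(Z × (Fin N → ℝ), Z))) d
    (isIso_hmap_of_homotopic _ ⟨fun z => (z, 0), by fun_prop⟩ ?_ ?_ d) _ _ ?_
  · exact ⟨⟨⟨fun p => (p.2.1, (p.1 : ℝ) • p.2.2), by fun_prop⟩, fun x => by simp, fun x => by simp⟩⟩
  · exact .refl _
  · rw [← cmap_comp, ← cmap_comp]
    rfl

lemma twConj_flipMap {N k : ℕ} (hk : k ≤ N) (r : C(Z, Z)) (d : ℕ) :
    TwConj (if k = 0 then 1 else -1 : ℤ)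
      (hmap (relMap (flipMap N r) (flipMap_mapsTo N k r)) (d + k)) (hmap (cmap r) d) := by
  induction k with
  | zero =>
    have h0 : Set.MapsTo (flipMap N r) ∅ ∅ := fun _ h => h.elim
    exact TwConj.of_eq (((twConj_congr_set (nonzeroBelow_zero N) _ _ h0 d).trans
      (twConj_relC_empty _ h0 d)).trans (twConj_flipMap_proj N r d)) (by simp)
  | succ k ih =>
    refine TwConj.of_eq ((twConj_flipMap_succ hk r (d + k)).trans (ih (by omega))) ?_
    rcases k with _ | k <;> simp

end

section

variable {R : Type} [CommRing R]

/-- The homology of `K` is free and concentrated in degrees divisible by `n`, with rank `c k` in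
degree `k * n`, where moreover `f` acts by the sign `(-1) ^ k`. -/
def HasRanks (n : ℕ) (c : ℕ → ℕ) (K : Cx R) (f : K ⟶ K) : Prop :=
  (∀ d, ¬ n ∣ d → Subsingleton (K.homology d)) ∧
  ∀ k, Module.Free R (K.homology (k * n)) ∧ Module.Finite R (K.homology (k * n)) ∧
    Module.finrank R (K.homology (k * n)) = c k ∧
    ∀ x : K.homology (k * n), hmap f (k * n) x = (-1 : R) ^ k • x

lemma eq_zero_of_eq_neg_of_free [IsDomain R] [CharZero R] {M : Type} [AddCommGroup M] [Module R M]
    [Module.Free R M] {x : M} (h : x = -x) : x = 0 := by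
  have : (2 : R) • x = 0 := by
    rw [two_smul]
    nth_rewrite 2 [h]
    exact add_neg_cancel x
  exact (smul_eq_zero.1 this).resolve_left two_ne_zero

lemma neg_one_pow_smul_injective {M : Type} [AddCommGroup M] [Module R M] (k : ℕ) :
    Function.Injective fun x : M => (-1 : R) ^ k • x := by
  intro x y h
  have := congrArg (fun x => (-1 : R) ^ k • x) h
  simpa only [smul_smul, ← pow_add, ← two_mul, pow_mul, neg_one_sq, one_pow, one_smul] using this

namespace HasRanks

variable {n : ℕ}

lemma congr {c c' : ℕ → ℕ} {K L : Cx R} {f : K ⟶ K} {f' : L ⟶ L} (h : HasRanks n c K f)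
    (hc : ∀ k, c k = c' k) (hf : ∀ d, TwConj (1 : R) (hmap f d) (hmap f' d)) :
    HasRanks n c' L f' := by
  refine ⟨fun d hd => ?_, fun k => ?_⟩
  · obtain ⟨e, -⟩ := hf d
    have := h.1 d hd
    exact e.symm.toEquiv.subsingleton
  · obtain ⟨e, he⟩ := hf (k * n)
    obtain ⟨h1, h2, h3, h4⟩ := h.2 k
    refine ⟨.of_equiv e, .equiv e, by rw [← e.finrank_eq, h3, hc], fun x => ?_⟩
    obtain ⟨x, rfl⟩ := e.surjective x
    rw [← one_smul R (hmap f' _ _), ← he, h4, map_smul]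

lemma of_eq {c : ℕ → ℕ} {K : Cx R} {f : K ⟶ K} (h : HasRanks n c K f) {d k : ℕ}
    (hd : d = k * n) : Module.Free R (K.homology d) ∧ Module.Finite R (K.homology d) ∧
    Module.finrank R (K.homology d) = c k ∧ ∀ x, hmap f d x = (-1 : R) ^ k • x := by
  subst hd
  exact h.2 k

lemma of_equiv [Nontrivial R] {c : ℕ → ℕ} {K : Cx R} {f : K ⟶ K} (hn : 0 < n)
    (hc : ∀ k, c k = if k = 0 then 1 else 0) (h : ∀ d, d ≠ 0 → Subsingleton (K.homology d))
    (e : K.homology 0 ≃ₗ[R] (PUnit →₀ R)) (hf : ∀ d x, hmap f d x = x) : HasRanks n c K f := by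
  refine ⟨fun d hd => h d fun h => hd (h ▸ dvd_zero _), fun k => ?_⟩
  rcases k with _ | k
  · suffices h : ∀ d, d = 0 → Module.Free R (K.homology d) ∧ Module.Finite R (K.homology d) ∧
        Module.finrank R (K.homology d) = c 0 from by
      obtain ⟨h1, h2, h3⟩ := h _ (zero_mul n)
      exact ⟨h1, h2, h3, fun x => by rw [hf, pow_zero, one_smul]⟩
    rintro _ rfl
    exact ⟨.of_equiv e.symm, .equiv e.symm, by rw [e.finrank_eq, hc]; simp⟩
  · have := h ((k + 1) * n) (by positivity)
    refine ⟨inferInstance, inferInstance, ?_, fun x => Subsingleton.elim _ _⟩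
    rw [hc]
    exact Module.finrank_zero_of_subsingleton

variable [IsDomain R] [CharZero R] {S : ShortComplex (Cx R)} (hS : S.ShortExact) (φ : S ⟶ S)
  (hn : 0 < n) {cX cZ : ℕ → ℕ} {L : Cx R} {fZ : L ⟶ L}
  (hX : HasRanks n cX S.X₂ φ.τ₂) (hZ : HasRanks n cZ L fZ)
  (h0 : ∀ d < n + 1, Subsingleton (S.X₃.homology d))
  (hT : ∀ d, TwConj (-1 : R) (hmap φ.τ₃ (d + (n + 1))) (hmap fZ d))

include hX hZ h0 hT in
lemma hmap_g_eq_zero (d : ℕ) (x : S.X₂.homology d) : hmap S.g d x = 0 := by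
  by_cases hd : d < n + 1
  · have := h0 d hd
    exact Subsingleton.elim _ _
  obtain ⟨d, rfl⟩ : ∃ d', d = d' + (n + 1) := ⟨d - (n + 1), by omega⟩
  obtain ⟨e, he⟩ := hT d
  by_cases h1 : n ∣ d
  swap
  · have := hZ.1 d h1
    have := e.toEquiv.subsingleton
    exact Subsingleton.elim _ _
  by_cases h2 : n ∣ d + (n + 1)
  swap
  · have := hX.1 _ h2
    rw [Subsingleton.elim x 0, map_zero]
  have h3 : n ∣ 1 := by
    rw [← add_assoc] at h2
    exact (Nat.dvd_add_right (h1.add dvd_rfl)).1 h2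
  obtain rfl : n = 1 := Nat.dvd_one.1 h3
  obtain ⟨-, -, -, hx⟩ := hX.of_eq (mul_one (d + (1 + 1))).symm
  obtain ⟨hfree, -, -, hz⟩ := hZ.of_eq (mul_one d).symm
  have hcomm : hmap S.g _ (hmap φ.τ₂ _ x) = hmap φ.τ₃ _ (hmap S.g _ x) := by
    rw [← hmap_comp, ← hmap_comp, φ.comm₂₃]
  rw [hx, map_smul] at hcomm
  have h5 := congrArg e hcomm
  have hs : (-1 : R) ^ (d + (1 + 1)) = (-1) ^ d := by ring
  rw [he, hz, map_smul, hs, neg_one_smul, ← smul_neg] at h5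
  refine e.injective ?_
  rw [map_zero]
  exact eq_zero_of_eq_neg_of_free (R := R) (neg_one_pow_smul_injective d h5)

include hS hn hX hZ h0 hT in
theorem of_shortExact (hφ : φ.τ₁ ≫ φ.τ₁ = 𝟙 _) :
    HasRanks n (fun k => cX k + if k = 0 then 0 else cZ (k - 1)) S.X₁ φ.τ₁ := by
  have hg := hmap_g_eq_zero φ hX hZ h0 hT
  have hg' : ∀ d, HomologicalComplex.homologyMap S.g d = 0 := fun d =>
    ModuleCat.hom_ext (LinearMap.ext (hg d))
  let T : ℕ → ShortComplex (ModuleCat R) := fun d => ShortComplex.mk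
    (hS.δ (d + 1) d rfl) (HomologicalComplex.homologyMap S.f d) (hS.δ_comp _ _ _)
  have hT' : ∀ d, (T d).ShortExact := fun d => {
    exact := hS.homology_exact₁ _ _ _
    mono_f := (hS.homology_exact₃ (d + 1) d rfl).mono_g (hg' _)
    epi_g := (hS.homology_exact₂ d).epi_f (hg' _) }
  have hdelta : ∀ d (a : S.X₃.homology (d + 1)),
      hmap φ.τ₁ d ((hS.δ (d + 1) d rfl).hom a) = (hS.δ (d + 1) d rfl).hom (hmap φ.τ₃ (d + 1) a) :=
    fun d a => LinearMap.congr_fun (congrArg ModuleCat.Hom.hom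
      (HomologicalComplex.HomologySequence.δ_naturality φ hS hS (d + 1) d rfl)) a
  refine ⟨fun d hd => ?_, fun k => ?_⟩
  · have h1 : Subsingleton (S.X₃.homology (d + 1)) := by
      by_cases h : d + 1 < n + 1
      · exact h0 _ h
      · obtain ⟨d, rfl⟩ : ∃ d', d = d' + n := ⟨d - n, by omega⟩
        obtain ⟨e, -⟩ := hT d
        have := hZ.1 d fun h => hd (h.add dvd_rfl)
        exact e.toEquiv.subsingleton
    have h2 := hX.1 d hd
    refine ⟨fun x y => sub_eq_zero.1 ?_⟩
    obtain ⟨a, ha⟩ := (ShortComplex.moduleCat_exact_iff _).1 (hT' d).exact (x - y)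
      (Subsingleton.elim (α := S.X₂.homology d) _ _)
    rw [← ha, Subsingleton.elim (α := S.X₃.homology (d + 1)) a 0, map_zero]
  · obtain ⟨x1, x2, x3, x4⟩ := hX.2 k
    have key : Module.Free R (S.X₃.homology (k * n + 1)) ∧
        Module.Finite R (S.X₃.homology (k * n + 1)) ∧
        Module.finrank R (S.X₃.homology (k * n + 1)) = (if k = 0 then 0 else cZ (k - 1)) ∧
        ∀ x, hmap φ.τ₃ (k * n + 1) x = (-1 : R) ^ k • x := by
      rcases k with _ | k
      · have := h0 (0 * n + 1) (by omega)
        refine ⟨inferInstance, inferInstance, ?_, fun x => Subsingleton.elim _ _⟩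
        rw [if_pos rfl]
        exact Module.finrank_zero_of_subsingleton
      · obtain ⟨z1, z2, z3, z4⟩ := hZ.2 k
        have hkn : (k + 1) * n + 1 = k * n + (n + 1) := by ring
        rw [hkn]
        obtain ⟨e, he⟩ := hT (k * n)
        refine ⟨.of_equiv e.symm, .equiv e.symm, by simpa using e.finrank_eq.trans z3, fun x => ?_⟩
        apply e.injective
        rw [he, z4, map_smul, smul_smul, pow_succ, mul_comm ((-1 : R) ^ k)]
    obtain ⟨q1, q2, q3, q4⟩ := key
    have i1 : Module.Free R (T (k * n)).X₁ := q1
    have i2 : Module.Free R (T (k * n)).X₃ := x1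
    have i3 : Module.Finite R (T (k * n)).X₁ := q2
    have i4 : Module.Finite R (T (k * n)).X₃ := x2
    have f1 : Module.Free R (S.X₁.homology (k * n)) := ModuleCat.free_shortExact (hT' (k * n))
    refine ⟨f1, ?_, ?_, fun x => ?_⟩
    · exact .of_basis (ModuleCat.Basis.ofShortExact (hT' (k * n)) (Module.Free.chooseBasis R _)
        (Module.Free.chooseBasis R _))
    · exact (ModuleCat.free_shortExact_finrank_add (hT' (k * n)) q3 x3).trans (add_comm _ _)
    · have hc : hmap S.f _ (hmap φ.τ₁ _ x) = hmap φ.τ₂ _ (hmap S.f _ x) := by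
        rw [← hmap_comp, ← hmap_comp, φ.comm₁₂]
      obtain ⟨a, ha⟩ := (ShortComplex.moduleCat_exact_iff _).1 (hT' (k * n)).exact
        (hmap φ.τ₁ _ x - (-1 : R) ^ k • x) (by
          refine (map_sub (hmap S.f (k * n)) _ _).trans ?_
          rw [hc, x4, map_smul, sub_self])
      set y : S.X₁.homology (k * n) := (hS.δ (k * n + 1) (k * n) rfl).hom a with hy
      have ha' : hmap φ.τ₁ _ x = (-1 : R) ^ k • x + y := by
        rw [hy, add_comm]
        exact sub_eq_iff_eq_add.1 ha.symm
      have hy' : hmap φ.τ₁ _ y = (-1 : R) ^ k • y := by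
        rw [hy, hdelta, q4, map_smul]
      have hxx : hmap φ.τ₁ _ (hmap φ.τ₁ _ x) = x := by
        rw [← hmap_comp, hφ, hmap_id]
      rw [ha', map_add, map_smul, ha', hy', smul_add, add_assoc, smul_smul, ← pow_add, ← two_mul,
        pow_mul, neg_one_sq, one_pow, one_smul, add_eq_left] at hxx
      have hy0 : y = 0 := by
        refine eq_zero_of_eq_neg_of_free (R := R) (neg_one_pow_smul_injective (R := R) k ?_)
        simp only [smul_neg]
        exact eq_neg_of_add_eq_zero_left hxx
      rw [ha', hy0, add_zero]

end HasRanks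

end

section

variable {X Y Z : Type} [TopologicalSpace X] [TopologicalSpace Y] [TopologicalSpace Z]

lemma relMap_id (A : Set X) : relMap (ContinuousMap.id X) (Set.mapsTo_id A) = 𝟙 (relC A) := by
  refine (chainsSub A).hom_ext fun n x => ?_
  have : ((cmap (ContinuousMap.id X)).f n).hom x = x := by
    rw [cmap_id]
    rfl
  exact congrArg (chainsSub A).cls this

lemma isIso_relMap_of_inverse {A : Set X} {B : Set Y} (f : C(X, Y)) (hf : Set.MapsTo f A B)
    (g : C(Y, X)) (hg : Set.MapsTo g B A) (h₁ : g.comp f = .id X) (h₂ : f.comp g = .id Y)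
    (d : ℕ) : IsIso (HomologicalComplex.homologyMap (relMap f hf) d) := by
  have : IsIso (relMap f hf) := by
    refine ⟨relMap g hg, ?_, ?_⟩
    · rw [← relMap_comp, ← relMap_id]
      congr
    · rw [← relMap_comp, ← relMap_id]
      congr
  infer_instance

/-- The inclusion of a subset into a larger subset as a continuous map. -/
def inclC {B W : Set X} (h : B ⊆ W) : C(B, W) := ⟨Set.inclusion h, continuous_inclusion h⟩

/-- The restriction of a continuous self-map to a stable subset. -/
def restrictC {A : Set X} (f : C(X, X)) (h : Set.MapsTo f A A) : C(A, A) :=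
  ⟨h.restrict, f.continuous.restrict h⟩

lemma inclC_mapsTo {B W : Set X} (h : B ⊆ W) (D : Set X) :
    Set.MapsTo (inclC h) (incl B ⁻¹' D) (incl W ⁻¹' D) := fun _ h => h

lemma restrictC_mapsTo {A D : Set X} (f : C(X, X)) (hA : Set.MapsTo f A A)
    (hD : Set.MapsTo f D D) : Set.MapsTo (restrictC f hA) (incl A ⁻¹' D) (incl A ⁻¹' D) :=
  fun _ h => hD h

lemma isIso_relMap_inclC {B W D : Set X} (hBW : B ⊆ W) (hB : IsOpen B) (hD : IsOpen D)
    (h : W ⊆ B ∪ D) (d : ℕ) : IsIso (HomologicalComplex.homologyMap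
      (relMap (inclC hBW) (inclC_mapsTo hBW D)) d) := by
  let φ : C(B, incl W ⁻¹' B) := ⟨fun b => ⟨⟨b.1, hBW b.2⟩, b.2⟩, by fun_prop⟩
  have hφ : Set.MapsTo φ (incl B ⁻¹' D) (incl (incl W ⁻¹' B) ⁻¹' (incl W ⁻¹' D)) := fun _ h => h
  have hι := Set.mapsTo_preimage (incl (incl W ⁻¹' B)) (incl W ⁻¹' D)
  have h1 := isIso_relMap_of_inverse φ hφ
    ⟨fun b => ⟨b.1.1, b.2⟩, by fun_prop⟩ (fun _ h => h) rfl rfl d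
  have h2 : IsIso (HomologicalComplex.homologyMap (relMap (incl (incl W ⁻¹' B)) hι) d) :=
    isIso_excision (hB.preimage (incl W).continuous) (hD.preimage (incl W).continuous)
      (Set.eq_univ_of_forall fun x => h x.2) d
  change IsIso (HomologicalComplex.homologyMap (relMap ((incl (incl W ⁻¹' B)).comp φ)
    (hι.comp hφ)) d)
  rw [relMap_comp φ hφ _ hι, HomologicalComplex.homologyMap_comp]
  infer_instance

/-- Excision: a relative homology group, with the action of a map, does not change when the
space is modified inside the subspace. -/
theorem twConj_relMap_restrictC {W W' D : Set X} (hW : IsOpen W) (hW' : IsOpen W')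
    (hD : IsOpen D) (h : W ⊆ W' ∪ D) (h' : W' ⊆ W ∪ D) (f : C(X, X)) (fW : Set.MapsTo f W W)
    (fW' : Set.MapsTo f W' W') (fD : Set.MapsTo f D D) (d : ℕ) :
    TwConj (1 : ℤ)
      (hmap (relMap (restrictC f fW) (restrictC_mapsTo f fW fD)) d)
      (hmap (relMap (restrictC f fW')
        (restrictC_mapsTo f fW' fD)) d) := by
  have fB := fW.inter_inter fW'
  have i1 := isIso_relMap_inclC (B := W ∩ W') Set.inter_subset_left (hW.inter hW') hD
    (fun x hx => (h hx).imp (fun h => ⟨hx, h⟩) id) d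
  have i2 := isIso_relMap_inclC (B := W ∩ W') Set.inter_subset_right (hW.inter hW') hD
    (fun x hx => (h' hx).imp (fun h => ⟨h, hx⟩) id) d
  have t1 := twConj_hmap _ d i1 (relMap (restrictC f fB) (restrictC_mapsTo f fB fD))
    (relMap (restrictC f fW) (restrictC_mapsTo f fW fD)) (by rw [← relMap_comp, ← relMap_comp]; rfl)
  have t2 := twConj_hmap _ d i2 (relMap (restrictC f fB) (restrictC_mapsTo f fB fD))
    (relMap (restrictC f fW') (restrictC_mapsTo f fW' fD)) (by rw [← relMap_comp, ← relMap_comp]; rfl)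
  exact .of_eq (t1.symm.trans t2) (by simp)

end

section

variable {X Y : Type} [TopologicalSpace X] [TopologicalSpace Y]

lemma isIso_hmap_of_homeomorph (h : X ≃ₜ Y) (d : ℕ) :
    IsIso (HomologicalComplex.homologyMap (cmap (h : C(X, Y))) d) := by
  refine isIso_hmap_of_homotopic _ (h.symm : C(Y, X)) ?_ ?_ d
  · rw [show (h.symm : C(Y, X)).comp (h : C(X, Y)) = .id X by ext x; simp]
  · rw [show (h : C(X, Y)).comp (h.symm : C(Y, X)) = .id Y by ext x; simp]

lemma HasRanks.of_homeomorph {n : ℕ} {c c' : ℕ → ℕ} {f : C(X, X)} {g : C(Y, Y)}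
    (hf : HasRanks n c _ (cmap f)) (hc : ∀ k, c k = c' k) (h : X ≃ₜ Y)
    (hfg : ∀ x, h (f x) = g (h x)) : HasRanks n c' _ (cmap g) := by
  refine hf.congr hc fun d => twConj_hmap _ d (isIso_hmap_of_homeomorph h d) _ _ ?_
  rw [← cmap_comp, ← cmap_comp]
  exact congrArg cmap (ContinuousMap.ext hfg)

lemma HasRanks.of_isEmpty [IsEmpty X] {n : ℕ} {c : ℕ → ℕ} (hc : ∀ k, c k = 0) (f : C(X, X)) :
    HasRanks n c _ (cmap f) := by
  have h (d : ℕ) : Subsingleton ((singC.obj (TopCat.of X)).homology d) := by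
    have : IsEmpty C(stdSimplex ℝ (Fin (d + 1)), X) :=
      ⟨fun σ => isEmptyElim (σ (Classical.arbitrary _))⟩
    have : Subsingleton ((singC.obj (TopCat.of X)).X d) :=
      (sbasis X d).repr.toEquiv.subsingleton
    exact ModuleCat.subsingleton_of_isZero
      (ShortComplex.exact_iff_isZero_homology _ |>.1
        (ShortComplex.exact_of_isZero_X₂ _
          (ModuleCat.isZero_of_subsingleton ((singC.obj (TopCat.of X)).X d))))
  refine ⟨fun d _ => h d, fun k => ?_⟩
  have := h (k * n)
  refine ⟨inferInstance, inferInstance, ?_, fun x => Subsingleton.elim _ _⟩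
  rw [hc]
  exact Module.finrank_zero_of_subsingleton

lemma HasRanks.of_contractible [ContractibleSpace X] {n : ℕ} (hn : 0 < n) {c : ℕ → ℕ}
    (hc : ∀ k, c k = if k = 0 then 1 else 0) (f : C(X, X)) : HasRanks n c _ (cmap f) := by
  have h (d : ℕ) (hd : d ≠ 0) : Subsingleton ((singC.obj (TopCat.of X)).homology d) := by
    have := subsingleton_singC_point hd
    exact (hequiv _ d (isIso_hmap_of_contractible (X := X) d)).toEquiv.subsingleton
  exact .of_equiv hn hc h
    ((hequiv _ 0 (isIso_hmap_of_contractible (X := X) 0)).trans singCPointHomologyZero)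
    fun d x => hmap_cmap_of_contractible f d x

end

section

variable {V ι : Type} [AddCommGroup V] [Module ℝ V] [TopologicalSpace V]
  [IsTopologicalAddGroup V] [ContinuousSMul ℝ V]

/-- The complement of the subspace arrangement of the `N`-fold powers of the kernels of a family
of linear forms. -/
def arr (N : ℕ) (α : ι → V →L[ℝ] ℝ) (s : Set ι) : Set (Fin N → V) :=
  {x | ∀ i ∈ s, ∃ k, α i (x k) ≠ 0}

omit [IsTopologicalAddGroup V] [ContinuousSMul ℝ V] in
lemma isOpen_arr (N : ℕ) (α : ι → V →L[ℝ] ℝ) {s : Set ι} (hs : s.Finite) :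
    IsOpen (arr N α s) := by
  have : arr N α s = ⋂ i ∈ s, ⋃ k, {x | α i (x k) ≠ 0} := by
    ext x
    simp [arr]
  rw [this]
  exact hs.isOpen_biInter fun i _ => isOpen_iUnion fun k =>
    isOpen_ne_fun (by fun_prop) continuous_const

variable (V) in
/-- The reflection reversing the first coordinate. -/
def flipC (N : ℕ) : C(Fin N → V, Fin N → V) :=
  ⟨fun x k => if k.1 = 0 then - x k else x k, by
    have hc : ∀ k : Fin N, Continuous fun x : Fin N → V => if k.1 = 0 then - x k else x k := by
      intro i
      split_ifs <;> fun_prop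
    fun_prop⟩

omit [ContinuousSMul ℝ V] in
lemma flipC_mapsTo (N : ℕ) (α : ι → V →L[ℝ] ℝ) (s : Set ι) :
    Set.MapsTo (flipC V N) (arr N α s) (arr N α s) := by
  intro x hx i hi
  obtain ⟨k, hk⟩ := hx i hi
  refine ⟨k, ?_⟩
  simp only [flipC, ContinuousMap.coe_mk]
  split_ifs
  · simpa using hk
  · exact hk

omit [Module ℝ V] [ContinuousSMul ℝ V] in
lemma flipC_flipC (N : ℕ) (x : Fin N → V) : flipC V N (flipC V N x) = x := by
  ext k
  simp only [flipC, ContinuousMap.coe_mk]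
  split_ifs <;> simp

/-- The reflection of the complement of an arrangement. -/
def flipArr (N : ℕ) (α : ι → V →L[ℝ] ℝ) (s : Set ι) : C(arr N α s, arr N α s) :=
  restrictC (flipC V N) (flipC_mapsTo N α s)

/-- The restriction of a family of linear forms to the kernel of one of them. -/
def resForm (α : ι → V →L[ℝ] ℝ) (e i : ι) : (α e).ker →L[ℝ] ℝ := (α i).comp (α e).ker.subtypeL

/-- The family of linear forms obtained by making all forms vanish on a vector. -/
noncomputable def projForm (α : ι → V →L[ℝ] ℝ) (e : ι) (v : V) (i : ι) : V →L[ℝ] ℝ :=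
  α i - α i v • α e

/-- Splitting of a projected arrangement. -/
def splitArr (N : ℕ) (α : ι → V →L[ℝ] ℝ) (s : Set ι) {e : ι} {v : V} (hv : α e v = 1) :
    arr N (projForm α e v) s ≃ₜ arr N (resForm α e) s × (Fin N → ℝ) where
  toFun x := (⟨fun k => ⟨x.1 k - α e (x.1 k) • v, by simp [hv]⟩, fun i hi => by
    obtain ⟨k, hk⟩ := x.2 i hi
    exact ⟨k, by simpa [projForm, resForm, mul_comm] using hk⟩⟩, fun k => α e (x.1 k))
  invFun p := ⟨fun k => (p.1.1 k : V) + p.2 k • v, fun i hi => by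
    obtain ⟨k, hk⟩ := p.1.2 i hi
    have h0 : α e (p.1.1 k) = 0 := (p.1.1 k).2
    refine ⟨k, ?_⟩
    simpa [projForm, resForm, hv, h0, mul_comm] using hk⟩
  left_inv x := by
    ext k
    simp
  right_inv p := by
    have h0 (k : Fin N) : α e (p.1.1 k) = 0 := (p.1.1 k).2
    refine Prod.ext (Subtype.ext (funext fun k => Subtype.ext ?_)) (funext fun k => ?_)
    · simp [hv, h0]
    · simp [hv, h0]
  continuous_toFun := by
    have h1 (k : Fin N) : Continuous fun x : arr N (projForm α e v) s => x.1 k :=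
      (continuous_apply k).comp continuous_subtype_val
    have h2 (k : Fin N) : Continuous fun x : arr N (projForm α e v) s => α e (x.1 k) :=
      (α e).continuous.comp (h1 k)
    exact Continuous.prodMk (Continuous.subtype_mk (continuous_pi fun k =>
      Continuous.subtype_mk ((h1 k).sub ((h2 k).smul continuous_const)) _) _) (continuous_pi h2)
  continuous_invFun := by
    refine Continuous.subtype_mk (continuous_pi fun k => ?_) _
    have h1 : Continuous fun p : arr N (resForm α e) s × (Fin N → ℝ) => (p.1.1 k : V) :=
      continuous_subtype_val.comp ((continuous_apply k).comp
        (continuous_subtype_val.comp continuous_fst))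
    fun_prop

end

section

variable {V ι : Type} [AddCommGroup V] [Module ℝ V] [TopologicalSpace V]
  [IsTopologicalAddGroup V] [ContinuousSMul ℝ V]

omit [IsTopologicalAddGroup V] [ContinuousSMul ℝ V] in
lemma projForm_apply_of_eq_zero (α : ι → V →L[ℝ] ℝ) {e : ι} (v : V) (i : ι) {x : V}
    (hx : α e x = 0) : projForm α e v i x = α i x := by
  simp [projForm, hx]

omit [IsTopologicalAddGroup V] [ContinuousSMul ℝ V] in
lemma forall_eq_zero_of_notMem_arr (N : ℕ) (α : ι → V →L[ℝ] ℝ) {e : ι} {x : Fin N → V}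
    (hx : x ∉ arr N α {e}) (k : Fin N) : α e (x k) = 0 := by
  by_contra h
  exact hx fun i hi => ⟨k, by rwa [Set.mem_singleton_iff.1 hi]⟩

lemma splitArr_flip (N : ℕ) (α : ι → V →L[ℝ] ℝ) (s : Set ι) {e : ι} {v : V} (hv : α e v = 1)
    (x : arr N (projForm α e v) s) :
    splitArr N α s hv (flipArr N _ s x) = flipMap N (flipArr N _ s) (splitArr N α s hv x) := by
  refine Prod.ext (Subtype.ext (funext fun k => Subtype.ext ?_)) (funext fun k => ?_)
  · change (if k.1 = 0 then - x.1 k else x.1 k) - α e (if k.1 = 0 then - x.1 k else x.1 k) • v =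
      ((if k.1 = 0 then - (splitArr N α s hv x).1.1 k else (splitArr N α s hv x).1.1 k :
        (α e).ker) : V)
    split_ifs
    · rw [map_neg, neg_smul, sub_neg_eq_add, Submodule.coe_neg]
      exact (neg_add_eq_sub _ _).trans (neg_sub (x.1 k) _).symm
    · rfl
  · change α e (if k.1 = 0 then - x.1 k else x.1 k) =
      if k.1 = 0 then - α e (x.1 k) else α e (x.1 k)
    split_ifs <;> simp

lemma splitArr_mem (N : ℕ) (α : ι → V →L[ℝ] ℝ) (s : Set ι) {e : ι} {v : V} (hv : α e v = 1)
    (x : arr N (projForm α e v) s) : splitArr N α s hv x ∈ nonzeroBelow _ N N ↔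
      x.1 ∈ arr N α {e} := by
  constructor
  · rintro ⟨k, -, hk⟩ i hi
    exact ⟨k, by rwa [Set.mem_singleton_iff.1 hi]⟩
  · intro h
    obtain ⟨k, hk⟩ := h e rfl
    exact ⟨k, k.2, hk⟩

variable (N : ℕ) (α : ι → V →L[ℝ] ℝ) {s : Set ι} (hs : s.Finite) {e : ι} {v : V} (hv : α e v = 1)

omit [ContinuousSMul ℝ V] in
lemma flipArr_mapsTo (N : ℕ) (α : ι → V →L[ℝ] ℝ) (s : Set ι) (β : ι → V →L[ℝ] ℝ) (t : Set ι) :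
    Set.MapsTo (flipArr N α s) (incl (arr N α s) ⁻¹' arr N β t) (incl (arr N α s) ⁻¹' arr N β t) :=
  restrictC_mapsTo _ _ (flipC_mapsTo N β t)

include hs hv in
lemma twConj_arr_pair (d : ℕ) : TwConj (1 : ℤ)
    (hmap (relMap (flipArr N α s) (flipArr_mapsTo N α s α {e})) d)
    (hmap (relMap (flipMap N (flipArr N (resForm α e) s))
      (flipMap_mapsTo N N (flipArr N (resForm α e) s))) d) := by
  have hsub (β γ : ι → V →L[ℝ] ℝ) (h : ∀ i (x : V), α e x = 0 → β i x = γ i x) :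
      arr N β s ⊆ arr N γ s ∪ arr N α {e} := by
    intro x hx
    by_cases hxe : x ∈ arr N α {e}
    · exact .inr hxe
    · refine .inl fun i hi => ?_
      obtain ⟨k, hk⟩ := hx i hi
      exact ⟨k, by rwa [← h i _ (forall_eq_zero_of_notMem_arr N α hxe k)]⟩
  have t1 := twConj_relMap_restrictC (isOpen_arr N α hs) (isOpen_arr N (projForm α e v) hs)
    (isOpen_arr N α (Set.finite_singleton e))
    (hsub _ _ fun i x hx => (projForm_apply_of_eq_zero α v i hx).symm)
    (hsub _ _ fun i x hx => projForm_apply_of_eq_zero α v i hx) (flipC V N)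
    (flipC_mapsTo N α s) (flipC_mapsTo N _ s) (flipC_mapsTo N α {e}) d
  let φ : C(arr N (projForm α e v) s, arr N (resForm α e) s × (Fin N → ℝ)) := splitArr N α s hv
  let ψ : C(arr N (resForm α e) s × (Fin N → ℝ), arr N (projForm α e v) s) :=
    (splitArr N α s hv).symm
  have hφ : Set.MapsTo φ (incl (arr N (projForm α e v) s) ⁻¹' arr N α {e})
    (nonzeroBelow (arr N (resForm α e) s) N N) := fun x hx => (splitArr_mem N α s hv x).2 hx
  have hψ : Set.MapsTo ψ (nonzeroBelow (arr N (resForm α e) s) N N)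
      (incl (arr N (projForm α e v) s) ⁻¹' arr N α {e}) := fun x hx => by
    rw [← (splitArr N α s hv).apply_symm_apply x, splitArr_mem] at hx
    exact hx
  have h1 : ψ.comp φ = .id _ := ContinuousMap.ext (splitArr N α s hv).symm_apply_apply
  have h2 : φ.comp ψ = .id _ := ContinuousMap.ext (splitArr N α s hv).apply_symm_apply
  have t2 := twConj_hmap _ d (isIso_relMap_of_inverse φ hφ ψ hψ h1 h2 d)
    (relMap (flipArr N (projForm α e v) s) (flipArr_mapsTo N _ s α {e}))
    (relMap (flipMap N (flipArr N (resForm α e) s)) (flipMap_mapsTo N N _)) (by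
      rw [← relMap_comp, ← relMap_comp]
      congr 1
      exact ContinuousMap.ext (splitArr_flip N α s hv))
  exact .of_eq (t1.trans t2) (mul_one 1)

end

section

variable {V ι : Type} [AddCommGroup V] [Module ℝ V] [TopologicalSpace V]
  [IsTopologicalAddGroup V] [ContinuousSMul ℝ V]

/-- The morphism of pair sequences induced by a map of pairs. -/
noncomputable def pairSCMap {X : Type} [TopologicalSpace X] {A : Set X} (f : C(X, X))
    (h : Set.MapsTo f A A) : pairSC A ⟶ pairSC A where
  τ₁ := cmap (restrictC f h)
  τ₂ := cmap f
  τ₃ := relMap f h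
  comm₁₂ := by
    change cmap _ ≫ cmap _ = cmap _ ≫ cmap _
    rw [← cmap_comp, ← cmap_comp]
    rfl
  comm₂₃ := rfl

/-- The intersection of the complements of two arrangements. -/
def interHomeo (N : ℕ) (α : ι → V →L[ℝ] ℝ) (s : Set ι) (e : ι) :
    (incl (arr N α s) ⁻¹' arr N α {e} : Set (arr N α s)) ≃ₜ arr N α (insert e s) where
  toFun x := ⟨x.1.1, fun i hi => hi.elim (fun h => x.2 i h) (x.1.2 i)⟩
  invFun x := ⟨⟨x.1, fun i hi => x.2 i (.inr hi)⟩, fun i hi => x.2 i (.inl hi)⟩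
  left_inv _ := rfl
  right_inv _ := rfl
  continuous_toFun := by fun_prop
  continuous_invFun := by fun_prop

theorem HasRanks.arr_insert {n : ℕ} (hn : 0 < n) {α : ι → V →L[ℝ] ℝ} {s : Set ι}
    (hs : s.Finite) {e : ι} (he : α e ≠ 0) {cX cZ c : ℕ → ℕ}
    (hX : HasRanks n cX _ (cmap (flipArr (n + 1) α s)))
    (hZ : HasRanks n cZ _ (cmap (flipArr (n + 1) (resForm α e) s)))
    (hc : ∀ k, cX k + (if k = 0 then 0 else cZ (k - 1)) = c k) :
    HasRanks n c _ (cmap (flipArr (n + 1) α (insert e s))) := by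
  obtain ⟨w, hw⟩ : ∃ w, α e w ≠ 0 := by
    by_contra! h
    exact he (ContinuousLinearMap.ext h)
  have hv : α e ((α e w)⁻¹ • w) = 1 := by simp [hw]
  have ht := twConj_arr_pair (n + 1) α hs hv
  have hinv : (restrictC (flipArr (n + 1) α s) (flipArr_mapsTo (n + 1) α s α {e})).comp
      (restrictC (flipArr (n + 1) α s) (flipArr_mapsTo (n + 1) α s α {e})) = .id _ :=
    ContinuousMap.ext fun x => Subtype.ext (Subtype.ext (flipC_flipC _ x.1.1))
  have key := HasRanks.of_shortExact (pairSC_shortExact (incl (arr (n + 1) α s) ⁻¹' arr (n + 1) α {e}))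
    (pairSCMap (flipArr (n + 1) α s) (flipArr_mapsTo (n + 1) α s α {e})) hn hX hZ (fun d hd => by
      obtain ⟨f, -⟩ := ht d
      have := subsingleton_nonzeroBelow (Z := arr (n + 1) (resForm α e) s) le_rfl hd
      exact f.toEquiv.subsingleton)
    (fun d => .of_eq ((ht (d + (n + 1))).trans (twConj_flipMap le_rfl _ d)) (by simp)) (by
      change cmap _ ≫ cmap _ = _
      rw [← cmap_comp, hinv, cmap_id]
      rfl)
  exact key.of_homeomorph hc (interHomeo (n + 1) α s e) fun _ => rfl

end

section

variable {V ι : Type} [AddCommGroup V] [Module ℝ V] [TopologicalSpace V]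
  [IsTopologicalAddGroup V] [ContinuousSMul ℝ V] [LinearOrder ι]

/-- No form indexed by `s` is spanned by smaller forms indexed by `F`. -/
def LinNBC (α : ι → V →L[ℝ] ℝ) (s F : Finset ι) : Prop :=
  ∀ f ∈ s, α f ∉ Submodule.span ℝ (α '' {e | e ∈ F ∧ e < f})

open Classical in
/-- The number of `LinNBC` sets of a given cardinality. -/
noncomputable def nbcCount (α : ι → V →L[ℝ] ℝ) (s : Finset ι) (k : ℕ) : ℕ :=
  ((s.powersetCard k).filter (LinNBC α s)).card

omit [LinearOrder ι] [IsTopologicalAddGroup V] [ContinuousSMul ℝ V] in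
lemma resForm_mem_span_iff {e : ι} {α : ι → V →L[ℝ] ℝ}
    (he : α e ≠ 0) (S : Set ι) (f : ι) :
    resForm α e f ∈ Submodule.span ℝ (resForm α e '' S) ↔
      α f ∈ Submodule.span ℝ (insert (α e) (α '' S)) := by
  obtain ⟨w, hw⟩ : ∃ w, α e w ≠ 0 := by
    by_contra! h
    exact he (ContinuousLinearMap.ext h)
  let ρ : (V →L[ℝ] ℝ) →ₗ[ℝ] ((α e).ker →L[ℝ] ℝ) :=
    { toFun β := β.comp (α e).ker.subtypeL
      map_add' _ _ := rfl
      map_smul' _ _ := rfl }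
  have hρ (i : ι) : resForm α e i = ρ (α i) := rfl
  have himg : resForm α e '' S = ρ '' (α '' S) := by
    rw [Set.image_image]
    rfl
  rw [himg, hρ, Submodule.span_image, Submodule.mem_map, Submodule.mem_span_insert]
  constructor
  · rintro ⟨g, hg, hgf⟩
    refine ⟨(α f - g) w / α e w, g, hg, ?_⟩
    ext x
    have hx : x - (α e x / α e w) • w ∈ (α e).ker := by simp [hw]
    have := DFunLike.congr_fun hgf ⟨_, hx⟩
    change g (x - _) = α f (x - _) at this
    simp only [map_sub, map_smul, smul_eq_mul] at this
    simp only [_root_.add_apply, _root_.smul_apply, smul_eq_mul,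
      _root_.sub_apply]
    field_simp at this ⊢
    linarith
  · rintro ⟨a, g, hg, hfg⟩
    refine ⟨g, hg, ContinuousLinearMap.ext fun x => ?_⟩
    have h0 : α e x = 0 := x.2
    change g x = α f x
    simp [hfg, h0]

omit [IsTopologicalAddGroup V] [ContinuousSMul ℝ V] in
lemma linNBC_insert_iff (α : ι → V →L[ℝ] ℝ) {e : ι} {s F : Finset ι} (hs : ∀ x ∈ s, e < x)
    (he : α e ≠ 0) (hF : F ⊆ s) : LinNBC α (insert e s) F ↔ LinNBC α s F := by
  refine ⟨fun h f hf => h f (Finset.mem_insert_of_mem hf), fun h f hf => ?_⟩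
  rcases Finset.mem_insert.1 hf with rfl | hf
  · have : {e | e ∈ F ∧ e < f} = ∅ := by
      ext x
      simpa using fun hx => (hs x (hF hx)).le
    simpa [this] using he
  · exact h f hf

omit [IsTopologicalAddGroup V] [ContinuousSMul ℝ V] in
lemma linNBC_insert_insert_iff (α : ι → V →L[ℝ] ℝ) {e : ι} {s F : Finset ι} (hs : ∀ x ∈ s, e < x)
    (he : α e ≠ 0) (hF : F ⊆ s) :
    LinNBC α (insert e s) (insert e F) ↔ LinNBC (resForm α e) s F := by
  have key (f : ι) (hf : f ∈ s) : α f ∉ Submodule.span ℝ (α '' {x | x ∈ insert e F ∧ x < f}) ↔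
      resForm α e f ∉ Submodule.span ℝ (resForm α e '' {x | x ∈ F ∧ x < f}) := by
    have : {x | x ∈ insert e F ∧ x < f} = insert e {x | x ∈ F ∧ x < f} := by
      ext x
      simp only [Finset.mem_insert, Set.mem_ofPred_eq, Set.mem_insert_iff]
      constructor
      · rintro ⟨rfl | h, h'⟩
        · exact .inl rfl
        · exact .inr ⟨h, h'⟩
      · rintro (rfl | h)
        · exact ⟨.inl rfl, hs f hf⟩
        · exact ⟨.inr h.1, h.2⟩
    rw [resForm_mem_span_iff he, this, Set.image_insert_eq]
  refine ⟨fun h f hf => (key f hf).1 (h f (Finset.mem_insert_of_mem hf)), fun h f hf => ?_⟩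
  rcases Finset.mem_insert.1 hf with rfl | hf
  · have : {x | x ∈ insert f F ∧ x < f} = ∅ := by
      ext x
      simpa using fun hx => hx.elim (fun h => h.ge) fun hx => (hs x (hF hx)).le
    rw [this]
    simpa using he
  · exact (key f hf).2 (h f hf)

omit [IsTopologicalAddGroup V] [ContinuousSMul ℝ V] in
lemma nbcCount_insert (α : ι → V →L[ℝ] ℝ) {e : ι} {s : Finset ι} (hs : ∀ x ∈ s, e < x)
    (he : α e ≠ 0) (k : ℕ) :
    nbcCount α s k + (if k = 0 then 0 else nbcCount (resForm α e) s (k - 1)) =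
      nbcCount α (insert e s) k := by
  classical
  have hes : e ∉ s := fun h => (hs e h).false
  have h1 (k : ℕ) : (s.powersetCard k).filter (LinNBC α (insert e s)) =
      (s.powersetCard k).filter (LinNBC α s) := Finset.filter_congr fun F hF =>
    linNBC_insert_iff α hs he (Finset.mem_powersetCard.1 hF).1
  rcases k with _ | k
  · simp only [nbcCount, if_true, add_zero]
    rw [← h1 0, Finset.powersetCard_zero, Finset.powersetCard_zero]
  · simp only [nbcCount]
    rw [Finset.powersetCard_succ_insert hes, Finset.filter_union, h1, Finset.filter_image,
      Finset.card_union_of_disjoint, Finset.card_image_of_injOn, if_neg k.succ_ne_zero,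
      Nat.add_sub_cancel]
    · congr 2
      exact Finset.filter_congr fun F hF =>
        (linNBC_insert_insert_iff α hs he (Finset.mem_powersetCard.1 hF).1).symm
    · intro F hF F' hF' h
      have hF := (Finset.mem_powersetCard.1 (Finset.mem_filter.1 hF).1).1
      have hF' := (Finset.mem_powersetCard.1 (Finset.mem_filter.1 hF').1).1
      rw [← Finset.erase_insert (fun h => hes (hF h)), h,
        Finset.erase_insert (fun h => hes (hF' h))]
    · rw [Finset.disjoint_left]
      intro F hF hF'
      obtain ⟨F', -, rfl⟩ := Finset.mem_image.1 hF'
      exact hes ((Finset.mem_powersetCard.1 (Finset.mem_filter.1 hF).1).1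
        (Finset.mem_insert_self e F'))

omit [IsTopologicalAddGroup V] [ContinuousSMul ℝ V] in
lemma nbcCount_eq_zero (α : ι → V →L[ℝ] ℝ) {e : ι} {s : Finset ι} (hes : e ∈ s)
    (he : α e = 0) (k : ℕ) : nbcCount α s k = 0 := by
  classical
  rw [nbcCount, Finset.card_eq_zero, Finset.filter_eq_empty_iff]
  exact fun F _ h => h e hes (he ▸ Submodule.zero_mem _)

omit [IsTopologicalAddGroup V] [ContinuousSMul ℝ V] in
lemma nbcCount_empty (α : ι → V →L[ℝ] ℝ) (k : ℕ) :
    nbcCount α ∅ k = if k = 0 then 1 else 0 := by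
  classical
  have h : LinNBC α ∅ ∅ := fun f hf => absurd hf (Finset.notMem_empty f)
  rcases k with _ | k
  · simp [nbcCount, Finset.filter_singleton, h]
  · rw [nbcCount, Finset.powersetCard_eq_empty.2 (by simp)]
    simp

/-- The homology of the complement of the arrangement of `n + 1`-fold powers of hyperplanes. -/
theorem hasRanks_arr {n : ℕ} (hn : 0 < n) (s : Finset ι) (α : ι → V →L[ℝ] ℝ) :
    HasRanks n (nbcCount α s) _ (cmap (flipArr (n + 1) α (s : Set ι))) := by
  induction s using Finset.induction_on_min generalizing V with
  | empty =>
    have h : arr (n + 1) α ((∅ : Finset ι) : Set ι) = Set.univ := by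
      simp [arr]
    have : ContractibleSpace (arr (n + 1) α ((∅ : Finset ι) : Set ι)) := by
      rw [h]
      exact (Homeomorph.Set.univ _).contractibleSpace
    exact .of_contractible hn (nbcCount_empty α) _
  | insert e s hs ih =>
    by_cases he : α e = 0
    · have : IsEmpty (arr (n + 1) α ((insert e s : Finset ι) : Set ι)) :=
        ⟨fun x => by simpa [he] using x.2 e (by simp)⟩
      exact .of_isEmpty (nbcCount_eq_zero α (Finset.mem_insert_self e s) he) _
    · rw [Finset.coe_insert]
      exact HasRanks.arr_insert hn s.finite_toSet he (ih α) (ih (resForm α e))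
        (nbcCount_insert α hs he)

end

section

variable {W : Type}

/-- The difference of the coordinates of the end points of an edge. -/
noncomputable def edgeForm (e : Sym2 W) : (W → ℝ) →L[ℝ] ℝ :=
  .proj (Quot.out e).1 - .proj (Quot.out e).2

lemma edgeForm_mk (i j : W) :
    edgeForm s(i, j) = .proj i - .proj j ∨ edgeForm s(i, j) = -(.proj i - .proj j) := by
  have h : s((Quot.out s(i, j)).1, (Quot.out s(i, j)).2) = s(i, j) := Quot.out_eq _
  rw [edgeForm]
  rcases Sym2.eq_iff.1 h with ⟨h1, h2⟩ | ⟨h1, h2⟩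
  · exact .inl (by rw [h1, h2])
  · exact .inr (by rw [h1, h2, neg_sub])

lemma edgeForm_mem_iff (S : Submodule ℝ ((W → ℝ) →L[ℝ] ℝ)) (i j : W) :
    edgeForm s(i, j) ∈ S ↔ .proj i - .proj j ∈ S := by
  rcases edgeForm_mk i j with h | h
  · rw [h]
  · rw [h, neg_mem_iff]

lemma edgeForm_apply_eq_zero_iff (i j : W) (x : W → ℝ) : edgeForm s(i, j) x = 0 ↔ x i = x j := by
  rcases edgeForm_mk i j with h | h <;> simp [h, sub_eq_zero, eq_comm]

lemma edgeForm_mem_span_iff (S : Set (Sym2 W)) (i j : W) :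
    edgeForm s(i, j) ∈ Submodule.span ℝ (edgeForm '' S) ↔
      (SimpleGraph.fromEdgeSet S).Reachable i j := by
  classical
  rw [edgeForm_mem_iff]
  constructor
  · intro h
    let x : W → ℝ := fun w => if (SimpleGraph.fromEdgeSet S).Reachable i w then 1 else 0
    have hx (f : (W → ℝ) →L[ℝ] ℝ) (hf : f ∈ Submodule.span ℝ (edgeForm '' S)) : f x = 0 := by
      induction hf using Submodule.span_induction with
      | mem f hf =>
        obtain ⟨e, he, rfl⟩ := hf
        induction e with | _ a b
        rw [edgeForm_apply_eq_zero_iff]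
        by_cases hab : a = b
        · rw [hab]
        · have hadj : (SimpleGraph.fromEdgeSet S).Adj a b :=
            (SimpleGraph.fromEdgeSet_adj S).2 ⟨he, hab⟩
          exact if_congr ⟨fun h => h.trans hadj.reachable, fun h => h.trans hadj.symm.reachable⟩
            rfl rfl
      | zero => rfl
      | add f g _ _ hf hg => rw [_root_.add_apply, hf, hg, add_zero]
      | smul a f _ hf => rw [_root_.smul_apply, hf, smul_zero]
    have := hx _ h
    by_contra hij
    simp [x, hij] at this
  · rintro ⟨p⟩
    induction p with
    | nil => simp
    | cons hadj _ ih =>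
      rename_i u v w _
      have h1 : edgeForm s(u, v) ∈ Submodule.span ℝ (edgeForm '' S) :=
        Submodule.subset_span ⟨_, ((SimpleGraph.fromEdgeSet_adj S).1 hadj).1, rfl⟩
      rw [edgeForm_mem_iff] at h1
      simpa using Submodule.add_mem _ h1 ih

variable [DecidableEq W] (G : SimpleGraph W)

lemma reachable_of_isCycleEdges {G : SimpleGraph W} {C : Finset (Sym2 W)} (hC : isCycleEdges G C)
    {i j : W} (hij : s(i, j) ∈ C) :
    (SimpleGraph.fromEdgeSet (C.erase s(i, j) : Set (Sym2 W))).Reachable i j := by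
  obtain ⟨v, w, hw, rfl⟩ := hC
  have hE : ∀ e ∈ w.edges,
      e ∈ (SimpleGraph.fromEdgeSet (w.edges.toFinset : Set (Sym2 W))).edgeSet := by
    intro e he
    rw [SimpleGraph.edgeSet_fromEdgeSet]
    exact ⟨by simpa using he, G.not_isDiag_of_mem_edgeSet (w.edges_subset_edgeSet he)⟩
  refine (SimpleGraph.adj_and_reachable_delete_edges_iff_exists_cycle.2
    ⟨v, w.transfer _ hE, hw.transfer hE, ?_⟩).2.mono ?_
  · rw [SimpleGraph.Walk.edges_transfer]
    exact List.mem_toFinset.1 hij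
  · intro a b hab
    rw [SimpleGraph.deleteEdges_adj, SimpleGraph.fromEdgeSet_adj] at hab
    exact (SimpleGraph.fromEdgeSet_adj _).2
      ⟨Finset.mem_coe.2 (Finset.mem_erase.2 ⟨hab.2, hab.1.1⟩), hab.1.2⟩

lemma exists_isCycleEdges_of_reachable {G : SimpleGraph W} {S : Set (Sym2 W)} (hS : S ⊆ G.edgeSet)
    {i j : W} (hij : G.Adj i j) (hmem : s(i, j) ∉ S)
    (h : (SimpleGraph.fromEdgeSet S).Reachable i j) :
    ∃ C, isCycleEdges G C ∧ s(i, j) ∈ C ∧ ↑C ⊆ insert s(i, j) S := by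
  obtain ⟨v, w, hw, hm⟩ := (SimpleGraph.adj_and_reachable_delete_edges_iff_exists_cycle
    (G := SimpleGraph.fromEdgeSet (insert s(i, j) S)) (v := i) (w := j)).1
    ⟨(SimpleGraph.fromEdgeSet_adj _).2 ⟨.inl rfl, hij.ne⟩, h.mono fun a b hab => by
      rw [SimpleGraph.fromEdgeSet_adj] at hab
      rw [SimpleGraph.deleteEdges_adj, SimpleGraph.fromEdgeSet_adj]
      exact ⟨⟨.inr hab.1, hab.2⟩, fun h => hmem (Set.mem_singleton_iff.1 h ▸ hab.1)⟩⟩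
  have hE : ∀ e ∈ w.edges, e ∈ insert s(i, j) S := fun e he =>
    ((SimpleGraph.edgeSet_fromEdgeSet (insert s(i, j) S)).le (w.edges_subset_edgeSet he)).1
  have hG : ∀ e ∈ w.edges, e ∈ G.edgeSet := fun e he =>
    (hE e he).elim (fun h => h ▸ hij) fun h => hS h
  refine ⟨_, ⟨v, w.transfer G hG, hw.transfer hG, rfl⟩, ?_, ?_⟩
  · rw [SimpleGraph.Walk.edges_transfer]
    exact List.mem_toFinset.2 hm
  · rw [SimpleGraph.Walk.edges_transfer]
    exact fun e he => hE e (List.mem_toFinset.1 he)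

variable [eo : LinearOrder (Sym2 W)] {G : SimpleGraph W} {F : Finset (Sym2 W)}

lemma isForestIn_of_isNBC (hF : ↑F ⊆ G.edgeSet) (h : isNBC G eo.le F) : isForestIn G F := by
  refine ⟨hF, fun v w hw => ?_⟩
  have hE : ∀ e ∈ w.edges, e ∈ F := fun e he =>
    ((SimpleGraph.edgeSet_fromEdgeSet (F : Set (Sym2 W))).le (w.edges_subset_edgeSet he)).1
  have hG : ∀ e ∈ w.edges, e ∈ G.edgeSet := fun e he => hF (hE e he)
  have hne : w.edges.toFinset.Nonempty := by
    rw [List.toFinset_nonempty_iff]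
    exact fun h0 => hw.not_nil (SimpleGraph.Walk.edges_eq_nil.1 h0)
  refine h _ ⟨_, w.edges.toFinset.max' hne, ⟨v, w.transfer G hG, hw.transfer hG, rfl⟩, ?_, ?_, rfl⟩ ?_
  all_goals rw [SimpleGraph.Walk.edges_transfer]
  · exact Finset.max'_mem _ _
  · exact fun f hf => Finset.le_max' _ f hf
  · exact fun e he => hE e (List.mem_toFinset.1 (Finset.mem_of_mem_erase he))

lemma linNBC_edgeForm_iff {E : Finset (Sym2 W)} (hE : ∀ e, e ∈ E ↔ e ∈ G.edgeSet)
    (hF : ↑F ⊆ G.edgeSet) : LinNBC edgeForm E F ↔ isNBC G eo.le F := by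
  constructor
  · rintro h _ ⟨C, e, hC, he, hmax, rfl⟩ hCF
    induction e with | _ i j
    have hCG : s(i, j) ∈ G.edgeSet := by
      obtain ⟨v, w, hw, rfl⟩ := hC
      exact w.edges_subset_edgeSet (List.mem_toFinset.1 he)
    refine h _ ((hE _).2 hCG) ((edgeForm_mem_span_iff _ _ _).2
      ((reachable_of_isCycleEdges hC he).mono (SimpleGraph.fromEdgeSet_mono fun e he => ?_)))
    obtain ⟨h1, h2⟩ := Finset.mem_erase.1 he
    exact ⟨hCF he, @lt_of_le_of_ne _ eo.toPartialOrder _ _ (hmax e h2) h1⟩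
  · intro h e he hspan
    induction e with | _ i j
    rw [edgeForm_mem_span_iff] at hspan
    obtain ⟨C, hC, hmem, hsub⟩ := exists_isCycleEdges_of_reachable (fun e he => hF he.1)
      ((hE _).1 he) (fun h => @lt_irrefl _ eo.toPreorder _ h.2) hspan
    refine h _ ⟨C, _, hC, hmem, fun f hf => ?_, rfl⟩ fun f hf => ?_
    · rcases hsub hf with rfl | h
      · exact eo.le_refl _
      · exact @le_of_lt _ eo.toPreorder _ _ h.2
    · exact ((hsub (Finset.mem_of_mem_erase hf)).resolve_left (Finset.ne_of_mem_erase hf)).1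

lemma nbcCount_edgeForm {E : Finset (Sym2 W)} (hE : ∀ e, e ∈ E ↔ e ∈ G.edgeSet) (k : ℕ) :
    nbcCount edgeForm E k = Nat.card {F : Finset (Sym2 W) //
      isForestIn G F ∧ isNBC G eo.le F ∧ F.card = k} := by
  classical
  rw [nbcCount, ← Nat.card_eq_finsetCard]
  refine Nat.card_congr (Equiv.subtypeEquivRight fun F => ?_)
  have hF : F ⊆ E ↔ ↑F ⊆ G.edgeSet := ⟨fun h e he => (hE e).1 (h he), fun h e he => (hE e).2 (h he)⟩
  rw [Finset.mem_filter, Finset.mem_powersetCard, hF]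
  constructor
  · rintro ⟨⟨h1, h2⟩, h3⟩
    rw [linNBC_edgeForm_iff hE h1] at h3
    exact ⟨isForestIn_of_isNBC h1 h3, h3, h2⟩
  · rintro ⟨h1, h2, h3⟩
    exact ⟨⟨h1.1, h3⟩, (linNBC_edgeForm_iff hE h1.1).2 h2⟩

end

/-- The chromatic configuration space as the complement of an arrangement. -/
noncomputable def chromConfHomeo (N m : ℕ) (G : SimpleGraph (Fin m)) {E : Finset (Sym2 (Fin m))}
    (hE : ∀ e, e ∈ E ↔ e ∈ G.edgeSet) : arr N edgeForm (E : Set (Sym2 (Fin m))) ≃ₜ chromConf N m G where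
  toFun x := ⟨fun i => WithLp.toLp 2 fun k => x.1 k i, fun i j hij h => by
    obtain ⟨k, hk⟩ := x.2 s(i, j) ((hE _).2 hij)
    exact hk ((edgeForm_apply_eq_zero_iff _ _ _).2 (congrArg (fun y => y k) h))⟩
  invFun x := ⟨fun k i => x.1 i k, fun e he => by
    induction e with | _ i j
    by_contra! h
    refine x.2 i j ((hE _).1 he) ?_
    ext k
    exact (edgeForm_apply_eq_zero_iff _ _ _).1 (h k)⟩
  left_inv _ := rfl
  right_inv _ := rfl
  continuous_toFun := by
    refine Continuous.subtype_mk (continuous_pi fun i =>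
      (PiLp.continuous_toLp 2 _).comp (continuous_pi fun k => ?_)) _
    exact (continuous_apply i).comp ((continuous_apply k).comp continuous_subtype_val)
  continuous_invFun := by
    refine Continuous.subtype_mk (continuous_pi fun k => continuous_pi fun i => ?_) _
    exact (continuous_apply k).comp ((PiLp.continuous_ofLp 2 _).comp
      ((continuous_apply i).comp continuous_subtype_val))

lemma HasRanks.homology {R : Type} [CommRing R] [Nontrivial R] {n : ℕ} {c : ℕ → ℕ} {K : Cx R}
    {f : K ⟶ K}
    (h : HasRanks n c K f) (d : ℕ) : Module.Free R (K.homology d) ∧ Module.Finite R (K.homology d) ∧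
      Module.finrank R (K.homology d) = if n ∣ d then c (d / n) else 0 := by
  by_cases hd : n ∣ d
  · obtain ⟨h1, h2, h3, -⟩ := h.of_eq (Nat.div_mul_cancel hd).symm
    exact ⟨h1, h2, by rw [h3, if_pos hd]⟩
  · have := h.1 d hd
    refine ⟨inferInstance, inferInstance, ?_⟩
    rw [if_neg hd]
    exact Module.finrank_zero_of_subsingleton

theorem stmt1 (m N : ℕ) (hN : 2 ≤ N)
    (G : SimpleGraph (Fin m)) (eo : LinearOrder (Sym2 (Fin m))) (d : ℕ) :
    Module.Free ℤ (SH d (chromConf N m G)) ∧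
    Module.Finite ℤ (SH d (chromConf N m G)) ∧
    Module.finrank ℤ (SH d (chromConf N m G)) =
      Nat.card {F : Finset (Sym2 (Fin m)) //
        isForestIn G F ∧ isNBC G eo.le F ∧ F.card * (N - 1) = d} := by
  classical
  obtain ⟨n, rfl⟩ : ∃ n, N = n + 1 := ⟨N - 1, by omega⟩
  have hn : 0 < n := by omega
  have hE (e : Sym2 (Fin m)) : e ∈ G.edgeFinset ↔ e ∈ G.edgeSet := SimpleGraph.mem_edgeFinset
  let h := chromConfHomeo (n + 1) m G hE
  have key := HasRanks.of_homeomorph (hasRanks_arr hn G.edgeFinset edgeForm)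
    (nbcCount_edgeForm hE) h
    (g := ⟨fun x => h (flipArr _ _ _ (h.symm x)), by fun_prop⟩) fun x => by simp
  obtain ⟨h1, h2, h3⟩ := key.homology d
  refine ⟨h1, h2, h3.trans ?_⟩
  rw [Nat.add_sub_cancel]
  split_ifs with hd
  · obtain ⟨k, rfl⟩ := hd
    rw [Nat.mul_div_cancel_left k hn]
    refine Nat.card_congr (Equiv.subtypeEquivRight fun F => ?_)
    rw [mul_comm n k, Nat.mul_left_inj hn.ne']
  · have : IsEmpty {F : Finset (Sym2 (Fin m)) //
        isForestIn G F ∧ isNBC G eo.le F ∧ F.card * n = d} :=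
      ⟨fun F => hd ⟨_, F.2.2.2.symm.trans (mul_comm _ _)⟩⟩
    exact Nat.card_of_isEmpty.symm
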